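/- Let Γ be a metric graph containing two disjoint cycles. Then the canonical linear system |K| has a cell of dimension at least g, where g = g(Γ) is the genus of Γ. -/

import Mathlib

open scoped ENNReal
open Set Function

namespace TropGraph

variable {G : Type*} [MetricSpace G]

/-! ### Metric graphs: length spaces with star-shaped neighbourhoods -/

/-- The length of a path, via the extended variation of its extension to `ℝ`. -/
noncomputable def pathLength {x y : G} (g : Path x y) : ℝ≥0∞ :=
  eVariationOn (fun t : ℝ => g.extend t) (Set.Icc 0 1)

/-- The star with `v` branches of radius `ε`: a disjoint union of `v` copies of `[0, ε)`
with all the zeroes identified. -/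
def starSetoid (v : ℕ) (ε : ℝ) : Setoid (Fin v × Set.Ico (0:ℝ) ε) where
  r a b := a = b ∨ ((a.2 : ℝ) = 0 ∧ (b.2 : ℝ) = 0)
  iseqv :=
    { refl := fun _ => Or.inl rfl
      symm := fun h => h.imp Eq.symm And.symm
      trans := fun h₁ h₂ => by
        rcases h₁ with rfl | h₁
        · exact h₂
        · rcases h₂ with rfl | h₂
          · exact Or.inr h₁
          · exact Or.inr ⟨h₁.1, h₂.2⟩ }

/-- The glued star-shaped space `⊔_{i=1}^v [0, ε) / ∼`. -/
def StarGlue (v : ℕ) (ε : ℝ) : Type :=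
  Quotient (starSetoid v ε)

instance (v : ℕ) (ε : ℝ) : TopologicalSpace (StarGlue v ε) := by
  unfold StarGlue; infer_instance

/-- `U` is a star-shaped neighbourhood of `x` of valence `v`. -/
def IsStarNbhdOf (x : G) (v : ℕ) (U : Set G) : Prop :=
  ∃ (ε : ℝ) (hε : 0 < ε) (φ : U ≃ₜ StarGlue v ε) (hx : x ∈ U),
    ∀ i : Fin v, φ ⟨x, hx⟩ = Quotient.mk (starSetoid v ε) (i, ⟨0, le_rfl, hε⟩)

/-- A metric graph: a compact length space in which every point has a star-shaped
neighbourhood. -/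
def IsMetricGraph (X : Type*) [MetricSpace X] : Prop :=
  CompactSpace X ∧
  (∀ x y : X, edist x y = ⨅ g : Path x y, pathLength g) ∧
  ∀ x : X, ∃ (v : ℕ) (U : Set X), U ∈ nhds x ∧ IsStarNbhdOf x v U

/-- `x` has valence `v`. -/
def HasValence (x : G) (v : ℕ) : Prop :=
  ∃ U ∈ nhds x, IsStarNbhdOf x v U

/-! ### Rational functions, tangent directions, orders and divisors -/

/-- `g` is a unit speed (isometric) path of length `ε` starting at `x`. -/
def IsUnitSpeedFrom (x : G) (ε : ℝ) (g : ℝ → G) : Prop :=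
  g 0 = x ∧ ∀ s ∈ Set.Ico (0:ℝ) ε, ∀ t ∈ Set.Ico (0:ℝ) ε, dist (g s) (g t) = |s - t|

/-- `f` has (integer) slope `s` along the path `g` near its starting point. -/
def HasSlopeAlong (f : G → ℝ) (g : ℝ → G) (s : ℤ) : Prop :=
  ∃ δ > (0:ℝ), ∀ t ∈ Set.Ico (0:ℝ) δ, f (g t) = f (g 0) + s * t

/-- A rational function: continuous, and linear with integer slope along every direction
near every point.  (On a compact metric graph this coincides with being continuous
piecewise linear with integer slopes.) -/
def IsRational (f : G → ℝ) : Prop :=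
  Continuous f ∧ ∀ (x : G) (ε : ℝ) (g : ℝ → G), 0 < ε → IsUnitSpeedFrom x ε g →
    ∃ s : ℤ, HasSlopeAlong f g s

/-- Unit speed paths emanating from `x`. -/
def UnitPath (x : G) : Type _ :=
  {g : ℝ → G // ∃ ε > (0:ℝ), IsUnitSpeedFrom x ε g}

/-- Two unit speed paths are equivalent when they agree near `0`. -/
def germSetoid (x : G) : Setoid (UnitPath x) where
  r g₁ g₂ := ∃ δ > (0:ℝ), ∀ t ∈ Set.Ico (0:ℝ) δ, g₁.1 t = g₂.1 t
  iseqv := by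
    constructor
    · intro g
      obtain ⟨ε, hε, _⟩ := g.2
      exact ⟨ε, hε, fun t _ => rfl⟩
    · rintro g₁ g₂ ⟨δ, hδ, h⟩
      exact ⟨δ, hδ, fun t ht => (h t ht).symm⟩
    · rintro g₁ g₂ g₃ ⟨δ₁, hδ₁, h₁⟩ ⟨δ₂, hδ₂, h₂⟩
      refine ⟨min δ₁ δ₂, lt_min hδ₁ hδ₂, fun t ht => ?_⟩
      have ht' := Set.mem_Ico.mp ht
      rw [h₁ t (Set.mem_Ico.mpr ⟨ht'.1, lt_of_lt_of_le ht'.2 (min_le_left _ _)⟩),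
        h₂ t (Set.mem_Ico.mpr ⟨ht'.1, lt_of_lt_of_le ht'.2 (min_le_right _ _)⟩)]

/-- The set of (unit) tangent directions at `x`: germs of unit speed paths from `x`. -/
def TangentDir (x : G) : Type _ :=
  Quotient (germSetoid x)

open scoped Classical in
/-- The outgoing slope of `f` along a tangent direction. -/
noncomputable def tangentSlope (f : G → ℝ) {x : G} (ζ : TangentDir x) : ℤ :=
  if h : ∃ s : ℤ, HasSlopeAlong f (Quotient.out ζ).1 s then h.choose else 0

/-- The order of `f` at `x`: the sum of the outgoing slopes of `f` at `x`. -/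
noncomputable def ordAt (f : G → ℝ) (x : G) : ℤ :=
  ∑ᶠ ζ : TangentDir x, tangentSlope f ζ

/-- Divisors are represented as finitely supported functions `G → ℤ`. -/
def FinSupp (D : G → ℤ) : Prop :=
  (Function.support D).Finite

/-- A divisor is effective when all its coefficients are nonnegative. -/
def Effective (D : G → ℤ) : Prop :=
  ∀ x, 0 ≤ D x

/-- The degree of a divisor. -/
noncomputable def deg (D : G → ℤ) : ℤ :=
  ∑ᶠ x, D x

/-- The degree of the restriction of a divisor to a subset. -/
noncomputable def degOn (S : Set G) (D : G → ℤ) : ℤ :=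
  ∑ᶠ x ∈ S, D x

/-- Linear equivalence of divisors: the difference is the divisor of a rational function. -/
def LinEquiv (D D' : G → ℤ) : Prop :=
  ∃ f : G → ℝ, IsRational f ∧ ∀ x, D' x = D x + ordAt f x

/-- `R(D)`: rational functions `f` with `D + div f ≥ 0`. -/
def RD (D : G → ℤ) : Set (G → ℝ) :=
  {f | IsRational f ∧ ∀ x, 0 ≤ D x + ordAt f x}

/-- The complete linear system `|D₀|` of effective divisors linearly equivalent to `D₀`. -/
def LinSys (D₀ : G → ℤ) : Set (G → ℤ) :=
  {D | FinSupp D ∧ Effective D ∧ LinEquiv D₀ D}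

/-- The oscillation `max f - min f` of a function. -/
noncomputable def osc (f : G → ℝ) : ℝ :=
  sSup (Set.range f) - sInf (Set.range f)

/-- The distance `d_∞` on a complete linear system. -/
noncomputable def linDist (D₁ D₂ : G → ℤ) : ℝ :=
  sInf {r : ℝ | ∃ f : G → ℝ, IsRational f ∧ (∀ x, D₂ x = D₁ x + ordAt f x) ∧ r = osc f}

/-- `f` is constant on `S`. -/
def ConstOn (f : G → ℝ) (S : Set G) : Prop :=
  ∀ x ∈ S, ∀ y ∈ S, f x = f y

/-! ### Subgraphs, arcs, components, firing -/

/-- An open arc: the isometric image of a nonempty open interval. -/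
def IsOpenArc (S : Set G) : Prop :=
  ∃ (a b : ℝ) (g : ℝ → G), a < b ∧
    (∀ s ∈ Set.Ioo a b, ∀ t ∈ Set.Ioo a b, dist (g s) (g t) = |s - t|) ∧
    S = g '' Set.Ioo a b

/-- The set of connected components of a subset. -/
def compsOf (S : Set G) : Set (Set G) :=
  {C | ∃ x ∈ S, C = connectedComponentIn S x}

/-- The outgoing degree of `x` with respect to a closed subgraph `Z`:
the number of tangent directions at `x` leaving `Z`. -/
noncomputable def degOut (Z : Set G) (x : G) : ℕ :=
  Nat.card {ζ : TangentDir x //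
    ∃ δ > (0:ℝ), ∀ t ∈ Set.Ioo (0:ℝ) δ, (Quotient.out ζ).1 t ∉ interior Z}

/-- A closed subgraph `Z` can fire with respect to `D` when `D(x) ≥ deg^out_Z(x)` for
all `x` on the boundary of `Z`. -/
def CanFire (D : G → ℤ) (Z : Set G) : Prop :=
  Z.Nonempty ∧ IsClosed Z ∧ (compsOf Z).Finite ∧
  ∀ x ∈ frontier Z, (degOut Z x : ℤ) ≤ D x

/-- A `v`-reduced divisor. -/
def IsReduced (v : G) (D : G → ℤ) : Prop :=
  (∀ x, x ≠ v → 0 ≤ D x) ∧ ∀ Z : Set G, v ∉ Z → ¬CanFire D Z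

/-- `D` is `V`-unsaturated: no closed subgraph whose boundary meets `V` can fire. -/
def Unsaturated (V : Set G) (D : G → ℤ) : Prop :=
  ¬∃ Z : Set G, (frontier Z ∩ V).Nonempty ∧ CanFire D Z

/-- A local maximum of `f`: a closed connected set on which `f` is constant, with a
neighbourhood on which `f` is strictly smaller outside of it. -/
def IsLocalMaxSet (f : G → ℝ) (C : Set G) : Prop :=
  IsClosed C ∧ IsConnected C ∧ ConstOn f C ∧
  ∃ U, IsOpen U ∧ C ⊆ U ∧ ∀ x ∈ U \ C, ∀ y ∈ C, f x < f y

/-! ### Models and genus -/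

/-- A model of the metric graph: a finite set of vertices whose complement is a finite
disjoint union of open arcs. -/
def IsGraphModel (V : Set G) : Prop :=
  V.Finite ∧ (compsOf Vᶜ).Finite ∧ ∀ C ∈ compsOf Vᶜ, IsOpenArc C

/-- A model has no self-loops: the closure of each open edge contains two distinct
endpoints. -/
def LoopFree (V : Set G) : Prop :=
  ∀ C ∈ compsOf Vᶜ, (closure C \ C).ncard = 2

/-- A model of an open subgraph `U`, together with valences of its vertices inside `U`. -/
def IsModelIn (U V : Set G) (val : G → ℕ) : Prop :=
  V ⊆ U ∧ V.Finite ∧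
  (∀ x ∈ V, ∃ W ∈ nhds x, W ⊆ U ∧ IsStarNbhdOf x (val x) W) ∧
  (compsOf (U \ V)).Finite ∧ (∀ C ∈ compsOf (U \ V), IsOpenArc C) ∧
  (compsOf U).Finite

/-- The genus (first Betti number) of an open subgraph `U`, i.e. of its completion:
computed from any model as `Σ val(x) - #edges - #vertices + #components`. -/
def HasGenusOpen (U : Set G) (g : ℤ) : Prop :=
  ∃ (V : Set G) (val : G → ℕ), IsModelIn U V val ∧
    g = (∑ᶠ x ∈ V, (val x : ℤ)) - ((compsOf (U \ V)).ncard : ℤ)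
        - (V.ncard : ℤ) + ((compsOf U).ncard : ℤ)

/-! ### Chip firing moves -/

/-- The open `ε`-neighbourhood of `Z`. -/
def ZNbhd (Z : Set G) (ε : ℝ) : Set G :=
  {x | Metric.infDist x Z < ε}

/-- The chip firing function `CF(Z, ε)`. -/
noncomputable def CF (Z : Set G) (ε : ℝ) : G → ℝ :=
  fun x => -min (Metric.infDist x Z) ε

/-- The data of a chip firing move: a closed subgraph with finitely many components such
that `Z_ε \ Z` is a disjoint union of open intervals. -/
def ChipData (Z : Set G) (ε : ℝ) : Prop :=
  IsClosed Z ∧ Z.Nonempty ∧ (compsOf Z).Finite ∧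
  ∀ C ∈ compsOf (ZNbhd Z ε \ Z), IsOpenArc C

/-- `h` is a chip firing move. -/
def IsCFMove (h : G → ℝ) : Prop :=
  ∃ (Z : Set G) (ε : ℝ), 0 < ε ∧ ChipData Z ε ∧ h = CF Z ε

/-- `f` is linear (with some real slope) on the open arc `C`. -/
def LinearOnArc (f : G → ℝ) (C : Set G) : Prop :=
  ∃ (a b : ℝ) (g : ℝ → G) (s c : ℝ), a < b ∧
    (∀ u ∈ Set.Ioo a b, ∀ t ∈ Set.Ioo a b, dist (g u) (g t) = |u - t|) ∧
    C = g '' Set.Ioo a b ∧ ∀ t ∈ Set.Ioo a b, f (g t) = s * t + c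

/-- A weighted chip firing move. -/
def IsWeightedCF (f : G → ℝ) : Prop :=
  IsRational f ∧ (¬∀ x y : G, f x = f y) ∧
  ∃ Z₁ Z₂ : Set G, IsClosed Z₁ ∧ IsClosed Z₂ ∧ Z₁.Nonempty ∧ Z₂.Nonempty ∧
    Disjoint Z₁ Z₂ ∧ Z₁ ≠ Set.univ ∧ Z₂ ≠ Set.univ ∧
    (∀ C ∈ compsOf (Z₁ ∪ Z₂)ᶜ, IsOpenArc C) ∧
    ConstOn f Z₁ ∧ ConstOn f Z₂ ∧
    ∀ C ∈ compsOf (Z₁ ∪ Z₂)ᶜ, LinearOnArc f C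

/-! ### Cells of the complete linear system -/

/-- The part of the support of a divisor lying in the interiors of the edges. -/
def edgeSupp (V : Set G) (D : G → ℤ) : Set G :=
  {x | x ∉ V ∧ D x ≠ 0}

/-- The dimension of the cell of `|D₀|` containing `D` in its relative interior:
the number of connected components of `Γ ∖ supp D_E`, minus one. -/
noncomputable def cellDim (V : Set G) (D : G → ℤ) : ℤ :=
  ((compsOf (edgeSupp V D)ᶜ).ncard : ℤ) - 1

/-- Two divisors of `|D₀|` have the same combinatorial type with respect to the model `V`
(they lie in the relative interior of the same cell): equal multiplicities on the
vertices, chip configurations on the edges related by a homeomorphism fixing the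
vertices and each edge, and equal slopes at all tangent directions at the vertices. -/
def SameType (V : Set G) (D₀ D₁ D₂ : G → ℤ) : Prop :=
  (∀ v ∈ V, D₁ v = D₂ v) ∧
  (∃ h : G ≃ₜ G, (∀ v ∈ V, h v = v) ∧ (∀ x ∉ V, h x ∈ connectedComponentIn Vᶜ x) ∧
    ∀ x, D₂ (h x) = D₁ x) ∧
  (∃ f₁ f₂ : G → ℝ, IsRational f₁ ∧ IsRational f₂ ∧
    (∀ x, D₁ x = D₀ x + ordAt f₁ x) ∧ (∀ x, D₂ x = D₀ x + ordAt f₂ x) ∧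
    ∀ v ∈ V, ∀ ζ : TangentDir v, tangentSlope f₁ ζ = tangentSlope f₂ ζ)

/-- `D'` lies in the closed cell `Δ_D` of `|D₀|`. -/
def InClosedCell (V : Set G) (D₀ D D' : G → ℤ) : Prop :=
  ∀ ε > (0:ℝ), ∃ D'' : G → ℤ, SameType V D₀ D D'' ∧ linDist D' D'' < ε

/-- `D` is generic in `|D₀|`: it lies in the relative interior of an inclusion-wise
maximal cell, i.e. all sufficiently nearby divisors of `|D₀|` lie in the closed cell
of `D`. -/
def Generic (V : Set G) (D₀ D : G → ℤ) : Prop :=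
  D ∈ LinSys D₀ ∧ ∃ ε > (0:ℝ), ∀ D' ∈ LinSys D₀, linDist D D' < ε → InClosedCell V D₀ D D'

/-- The rank of `D` is at least `d`: for every effective divisor `E` of degree `d`,
`|D - E|` is nonempty. -/
def rankGe (D : G → ℤ) (d : ℕ) : Prop :=
  ∀ E : G → ℤ, FinSupp E → Effective E → deg E = (d : ℤ) →
    ∃ D' : G → ℤ, FinSupp D' ∧ Effective D' ∧ LinEquiv (fun x => D x - E x) D'

/-! ### Cycles, the canonical divisor and realizability -/

/-- A simple cycle: a subset homeomorphic to a circle. -/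
def IsCycleSet (C : Set G) : Prop :=
  Nonempty (C ≃ₜ AddCircle (1 : ℝ))

/-- The canonical divisor `K + div f` for a vertex valence function `val`. -/
noncomputable def canDiv (val : G → ℕ) (f : G → ℝ) : G → ℤ :=
  fun x => (val x : ℤ) - 2 + ordAt f x

/-- The enhanced-level-graph invariant `k(ζ) = -s_ζ(f) - 1` of a tangent direction. -/
noncomputable def kVal (f : G → ℝ) {v : G} (ζ : TangentDir v) : ℤ :=
  -(tangentSlope f ζ) - 1

/-- `v` is an inconvenient vertex of the enhanced level graph `Γ⁺(f)` (all vertex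
weights `h ≡ 0`): no `k`-value equals `-1`, and some `k`-value (of a half-edge, or of
one of the `D(v)` attached legs, which carry `k = 1`) exceeds
`Σ_{k_j < 0} (-k_j) - #{k_j < 0} - 1`.  (Legs have `k = 1 > 0` and so never contribute
to the sums, and their `k`-value is `≠ -1`.) -/
def Inconvenient (val : G → ℕ) (f : G → ℝ) (v : G) : Prop :=
  (∀ ζ : TangentDir v, kVal f ζ ≠ -1) ∧
  ∃ k₀ : ℤ, ((∃ ζ : TangentDir v, kVal f ζ = k₀) ∨ (0 < canDiv val f v ∧ k₀ = 1)) ∧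
    (∑ᶠ ζ ∈ {ζ : TangentDir v | kVal f ζ < 0}, (-kVal f ζ))
      - (({ζ : TangentDir v | kVal f ζ < 0}).ncard : ℤ) - 1 < k₀

/-- The realizability criterion of Möller–Ulirsch–Werner for the effective canonical
divisor `K + div f`: every inconvenient vertex, and every open arc on which `f` is
constant, away from the bends of `f` and from higher-valence points, is contained in a
simple cycle lying above it. -/
def RealizableFn (val : G → ℕ) (f : G → ℝ) : Prop :=
  (∀ v, Inconvenient val f v →
    ∃ Z : Set G, IsCycleSet Z ∧ v ∈ Z ∧ ∀ z ∈ Z, f v ≤ f z) ∧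
  (∀ A : Set G, IsOpenArc A → ConstOn f A → (∀ x ∈ A, ordAt f x = 0 ∧ val x = 2) →
    ∃ Z : Set G, IsCycleSet Z ∧ A ⊆ Z ∧ ∀ z ∈ Z, ∀ a ∈ A, f a ≤ f z)

/-- The realizability locus inside the canonical linear system. -/
def RealSet (val : G → ℕ) : Set (G → ℤ) :=
  {D | ∃ f : G → ℝ, IsRational f ∧ (∀ x, D x = (val x : ℤ) - 2 + ordAt f x) ∧
    RealizableFn val f}

/-! ### Tropical linear series -/

/-- The cone `R(𝔡, D)` of rational functions `f` with `D + div f ∈ 𝔡`. -/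
def coneOf (D : G → ℤ) (𝔡 : Set (G → ℤ)) : Set (G → ℝ) :=
  {f | IsRational f ∧ (fun x => D x + ordAt f x) ∈ 𝔡}

/-- A tropical linear series: a tropically convex subset of a complete linear system,
i.e. one whose cone of rational functions is a tropical submodule. -/
def TropLinearSeries (D₀ : G → ℤ) (𝔡 : Set (G → ℤ)) : Prop :=
  𝔡 ⊆ LinSys D₀ ∧
  (∀ f ∈ coneOf D₀ 𝔡, ∀ g ∈ coneOf D₀ 𝔡, (fun x => max (f x) (g x)) ∈ coneOf D₀ 𝔡) ∧
  (∀ c : ℝ, ∀ f ∈ coneOf D₀ 𝔡, (fun x => c + f x) ∈ coneOf D₀ 𝔡)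

/-- The rank of the tropical linear series `𝔡` is at least `d`:
`𝔡(-E)` is nonempty for every effective divisor `E` of degree `d`. -/
def lsRankGe (𝔡 : Set (G → ℤ)) (d : ℕ) : Prop :=
  ∀ E : G → ℤ, FinSupp E → Effective E → deg E = (d : ℤ) →
    ∃ D ∈ 𝔡, ∀ x, E x ≤ D x

/-- `D` splits in `𝔡`: some non-constant `f ∈ R(𝔡, D)`, with maximum locus `Z`, has a
boundary point `x ∈ ∂Z` with `D(x) + ord_x(f) > 0`. -/
def Splits (𝔡 : Set (G → ℤ)) (D : G → ℤ) : Prop :=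
  ∃ f ∈ coneOf D 𝔡, (¬∀ x y : G, f x = f y) ∧
    ∃ x ∈ frontier {y | ∀ z, f z ≤ f y}, 0 < D x + ordAt f x

/-- The pairing of a divisor with a test function. -/
noncomputable def pairing (D : G → ℤ) (φ : G → ℝ) : ℝ :=
  ∑ᶠ x, (D x : ℝ) * φ x

/-- The tangent space of `X` at `D` has dimension at least `r`: there are `r`
one-sided differentiable paths through `D` inside `X` whose derivatives (as linear
functionals on rational test functions) are linearly independent. -/
def TangentDimGe (X : Set (G → ℤ)) (D : G → ℤ) (r : ℕ) : Prop :=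
  ∃ (c : Fin r → ℝ → G → ℤ) (L : Fin r → (G → ℝ) → ℝ) (ε : ℝ), 0 < ε ∧
    (∀ i, c i 0 = D) ∧ (∀ i, ∀ t ∈ Set.Ico (0:ℝ) ε, c i t ∈ X) ∧
    (∀ i, ∀ φ : G → ℝ, IsRational φ →
      HasDerivWithinAt (fun t => pairing (c i t) φ) (L i φ) (Set.Ici 0) 0) ∧
    LinearIndependent ℝ L


/-! ### Distances and level functions on finite graphs -/

open scoped Classical in
/-- A finite weighted graph in which everything is reachable from `Z` has a distance function
to `Z`. -/
theorem exists_graph_dist {α E : Type*} [Finite E] (W Z : Set α)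
    (src : E × Bool → α) (hsrc : ∀ δ, src δ ∈ W) (len : E → ℝ) (hlen : ∀ e, 0 < len e)
    (hreach : ∀ w ∈ W, ∃ z ∈ Z,
      Relation.ReflTransGen (fun a b => ∃ δ : E × Bool, src δ = a ∧ src (δ.1, !δ.2) = b) z w) :
    ∃ d : α → ℝ, (∀ z ∈ Z, d z = 0) ∧ (∀ w ∈ W, 0 ≤ d w) ∧
      (∀ δ, d (src δ) ≤ d (src (δ.1, !δ.2)) + len δ.1) ∧
      ∀ w ∈ W, w ∉ Z → ∃ δ, src δ = w ∧ d w = d (src (δ.1, !δ.2)) + len δ.1 := by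
  set P : Set (α → ℝ) := {q | (∀ z ∈ Z, q z = 0) ∧
    ∀ δ, q (src δ) ≤ q (src (δ.1, !δ.2)) + len δ.1} with hP
  have h0 : (fun _ => (0 : ℝ)) ∈ P := ⟨fun _ _ => rfl, fun δ => by simpa using (hlen δ.1).le⟩
  have hbdd : ∀ w ∈ W, BddAbove ((fun q : α → ℝ => q w) '' P) := by
    intro w hw
    obtain ⟨z, hz, hzw⟩ := hreach w hw
    suffices ∃ c, ∀ q ∈ P, q w ≤ c by
      obtain ⟨c, hc⟩ := this
      exact ⟨c, by rintro _ ⟨q, hq, rfl⟩; exact hc q hq⟩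
    clear hw
    induction hzw with
    | refl => exact ⟨0, fun q hq => (hq.1 z hz).le⟩
    | tail _ hab ih =>
      obtain ⟨c, hc⟩ := ih
      obtain ⟨δ, rfl, rfl⟩ := hab
      refine ⟨c + len δ.1, fun q hq => ?_⟩
      have h1 := hq.2 (δ.1, !δ.2)
      simp only [Bool.not_not] at h1
      linarith [hc q hq]
  set d : α → ℝ := fun w => sSup ((fun q : α → ℝ => q w) '' P) with hd
  have hle : ∀ w ∈ W, ∀ q ∈ P, q w ≤ d w := fun w hw q hq =>
    le_csSup (hbdd w hw) ⟨q, hq, rfl⟩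
  have hne : ∀ w, ((fun q : α → ℝ => q w) '' P).Nonempty := fun w => ⟨_, _, h0, rfl⟩
  have hdZ : ∀ z ∈ Z, d z = 0 := by
    intro z hz
    have : (fun q : α → ℝ => q z) '' P = {0} := by
      ext c
      constructor
      · rintro ⟨q, hq, rfl⟩
        exact hq.1 z hz
      · rintro rfl
        exact ⟨_, h0, rfl⟩
    simp [hd, this]
  have hdL : ∀ δ, d (src δ) ≤ d (src (δ.1, !δ.2)) + len δ.1 := by
    intro δ
    refine csSup_le (hne _) ?_
    rintro _ ⟨q, hq, rfl⟩
    linarith [hq.2 δ, hle _ (hsrc (δ.1, !δ.2)) q hq]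
  refine ⟨d, hdZ, fun w hw => hle w hw _ h0, hdL, fun w hw hwZ => ?_⟩
  by_contra! hcon
  have hev : ∀ᶠ ε in nhdsWithin (0 : ℝ) (Ioi 0), ∀ δ : E × Bool, src δ = w →
      d w + ε ≤ d (src (δ.1, !δ.2)) + len δ.1 := by
    rw [Filter.eventually_all]
    intro δ
    by_cases hδ : src δ = w
    · have h1 : d w < d (src (δ.1, !δ.2)) + len δ.1 :=
        lt_of_le_of_ne (hδ ▸ hdL δ) (hcon δ hδ)
      filter_upwards [Ioo_mem_nhdsGT (sub_pos.2 h1)] with ε hε _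
      linarith [hε.2]
    · exact Filter.Eventually.of_forall fun ε h => absurd h hδ
  obtain ⟨ε, hε, hε0⟩ := (hev.and self_mem_nhdsWithin).exists
  have hε0 : 0 < ε := hε0
  have hq : Function.update d w (d w + ε) ∈ P := by
    refine ⟨fun z hz => ?_, fun δ => ?_⟩
    · rw [Function.update_of_ne (by rintro rfl; exact hwZ hz)]
      exact hdZ z hz
    · by_cases h1 : src δ = w
      · have h3 := hε δ h1
        by_cases h2 : src (δ.1, !δ.2) = w
        · rw [h1, h2]; linarith [hlen δ.1]
        · rw [h1, Function.update_self, Function.update_of_ne h2]; exact h3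
      · have h3 := hdL δ
        by_cases h2 : src (δ.1, !δ.2) = w
        · rw [h2, Function.update_self, Function.update_of_ne h1]; rw [h2] at h3; linarith
        · rw [Function.update_of_ne h1, Function.update_of_ne h2]; exact h3
  have := hle w hw _ hq
  rw [Function.update_self] at this
  linarith

/-- Iterating a map which strictly decreases a function off its fixed points. -/
theorem exists_root {α : Type*} (W : Finset α) (par : α → α) (d : α → ℝ)
    (hW : ∀ w ∈ W, par w ∈ W) (hd : ∀ w ∈ W, par w ≠ w → d (par w) < d w) :
    ∃ root : α → α, ∀ w ∈ W, root w ∈ W ∧ par (root w) = root w ∧ root (par w) = root w ∧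
      d (root w) ≤ d w ∧ (par w = w → root w = w) := by
  have hit : ∀ n, ∀ w ∈ W, par^[n] w ∈ W := fun n w hw => by
    induction n with
    | zero => exact hw
    | succ n ih => rw [Function.iterate_succ_apply']; exact hW _ ih
  have key : ∀ w ∈ W, ∀ n, par (par^[n] w) = par^[n] w ∨
      (W.filter (fun v => d v < d (par^[n] w))).card + n ≤ W.card := by
    intro w hw n
    induction n with
    | zero => exact Or.inr (by simpa using Finset.card_filter_le _ _)
    | succ n ih =>
      rw [Function.iterate_succ_apply']
      by_cases hfix : par (par^[n] w) = par^[n] w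
      · left; rw [hfix, hfix]
      · right
        have hlt := hd _ (hit n w hw) hfix
        have h1 := ih.resolve_left hfix
        have h2 : (W.filter (fun v => d v < d (par (par^[n] w)))).card <
            (W.filter (fun v => d v < d (par^[n] w))).card := by
          apply Finset.card_lt_card
          rw [Finset.ssubset_iff_of_subset
            (Finset.monotone_filter_right _ fun v _ hv => lt_trans hv hlt)]
          exact ⟨par (par^[n] w), by simp [hW _ (hit n w hw), hlt], by simp⟩
        omega
  have hfix : ∀ w ∈ W, par (par^[W.card + 1] w) = par^[W.card + 1] w := fun w hw =>
    (key w hw _).resolve_right (by omega)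
  refine ⟨par^[W.card + 1], fun w hw => ⟨hit _ w hw, hfix w hw, ?_, ?_, ?_⟩⟩
  · rw [← Function.iterate_succ_apply, Function.iterate_succ_apply', hfix w hw]
  · have : ∀ n, d (par^[n] w) ≤ d w := fun n => by
      induction n with
      | zero => exact le_rfl
      | succ n ih =>
        rw [Function.iterate_succ_apply']
        by_cases h : par (par^[n] w) = par^[n] w
        · rw [h]; exact ih
        · exact (hd _ (hit n w hw) h).le.trans ih
    exact this _
  · exact fun h => Function.iterate_fixed h _

set_option maxHeartbeats 1000000 in
open scoped Classical in
/-- Level data on a finite weighted graph with two disjoint families of cycles: `h` is the height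
of a vertex, `τ` the length along which the function descends from the start of a dart, and
`lab` labels the connected pieces of vertices. -/
theorem exists_levels {α E : Type*} [Fintype E] (W Z₁ Z₂ : Finset α)
    (hZ₁ : Z₁.Nonempty) (hZ₂ : Z₂.Nonempty) (hZW₁ : Z₁ ⊆ W) (hZW₂ : Z₂ ⊆ W)
    (hZ : Disjoint Z₁ Z₂)
    (src : E × Bool → α) (hsrc : ∀ δ, src δ ∈ W) (len : E → ℝ) (hlen : ∀ e, 0 < len e)
    (F₁ F₂ : Set E) (hF₁ : ∀ δ, δ.1 ∈ F₁ → src δ ∈ Z₁) (hF₂ : ∀ δ, δ.1 ∈ F₂ → src δ ∈ Z₂)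
    (hc₁ : ∀ w ∈ Z₁, (Finset.univ.filter fun δ : E × Bool => src δ = w ∧ δ.1 ∈ F₁).card = 2)
    (hc₂ : ∀ w ∈ Z₂, (Finset.univ.filter fun δ : E × Bool => src δ = w ∧ δ.1 ∈ F₂).card = 2)
    (hreach : ∀ w ∈ W, ∃ z ∈ Z₁,
      Relation.ReflTransGen (fun a b => ∃ δ : E × Bool, src δ = a ∧ src (δ.1, !δ.2) = b) z w)
    (bad : E × Bool → Set ℝ) (hbad : ∀ δ, (bad δ).Finite)
    (hbads : ∀ δ, ∀ t ∈ bad (δ.1, !δ.2), len δ.1 - t ∈ bad δ) :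
    ∃ (h : α → ℝ) (τ : E × Bool → ℝ) (lab : α → α ⊕ Bool),
      (∀ δ, 0 ≤ τ δ) ∧ (∀ δ, τ δ + τ (δ.1, !δ.2) ≤ len δ.1) ∧
      (∀ δ, h (src δ) - τ δ = h (src (δ.1, !δ.2)) - τ (δ.1, !δ.2)) ∧
      (∀ w ∈ W, ∑ δ with src δ = w,
        ((if τ δ = 0 then 1 else 0) + (if τ (δ.1, !δ.2) = len δ.1 then 1 else 0) : ℤ) = 2) ∧
      (∀ δ, τ δ + τ (δ.1, !δ.2) = len δ.1 → τ δ = 0 ∨ τ (δ.1, !δ.2) = 0) ∧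
      (∀ δ, 0 < τ δ → τ δ < len δ.1 → τ δ ∉ bad δ) ∧
      (∀ δ, τ δ = 0 → (τ (δ.1, !δ.2) = 0 ∨ τ (δ.1, !δ.2) = len δ.1) →
        lab (src δ) = lab (src (δ.1, !δ.2))) ∧
      Fintype.card E + 2 ≤ W.card + (W.image lab).card +
        (Finset.univ.filter fun e : E => ∀ b, 0 < τ (e, b)).card := by
  set r : E × Bool → E × Bool := fun δ => (δ.1, !δ.2) with hr
  have hrr : ∀ δ, r (r δ) = δ := fun δ => by simp [hr]
  have hr1 : ∀ δ, (r δ).1 = δ.1 := fun δ => rfl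
  have hdisjZ : ∀ w, w ∈ Z₁ → w ∉ Z₂ := fun w h1 h2 => Finset.disjoint_left.1 hZ h1 h2
  obtain ⟨d, hdZ, hd0, hdL, hdex⟩ := exists_graph_dist (W : Set α) (Z₁ ∪ Z₂ : Finset α) src
    (fun δ => hsrc δ) len hlen (fun w hw => by
      obtain ⟨z, hz, h⟩ := hreach w hw
      exact ⟨z, by simp [hz], h⟩)
  have hdZ₁ : ∀ z ∈ Z₁, d z = 0 := fun z hz => hdZ z (by simp [hz])
  have hdZ₂ : ∀ z ∈ Z₂, d z = 0 := fun z hz => hdZ z (by simp [hz])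
  change ∀ δ, d (src δ) ≤ d (src (r δ)) + len δ.1 at hdL
  -- edges realising the distance
  set up : E × Bool → Prop := fun δ => d (src δ) = d (src (r δ)) + len δ.1 with hup
  have hupZ : ∀ δ, up δ → src δ ∉ Z₁ ∧ src δ ∉ Z₂ := by
    intro δ hδ
    have h1 := hd0 _ (hsrc (r δ))
    have h2 := hlen δ.1
    constructor
    · intro hz; have := hdZ₁ _ hz; simp only [hup] at hδ; linarith
    · intro hz; have := hdZ₂ _ hz; simp only [hup] at hδ; linarith
  have hupr : ∀ δ, up δ → ¬ up (r δ) := by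
    intro δ h1 h2
    simp only [hup, hrr, hr1] at h1 h2
    linarith [hlen δ.1]
  set U : α → Finset (E × Bool) := fun w => Finset.univ.filter fun δ => src δ = w ∧ up δ with hU
  have hUne : ∀ w ∈ W, w ∉ Z₁ → w ∉ Z₂ → (U w).Nonempty := by
    intro w hw h1 h2
    obtain ⟨δ, hδ, h⟩ := hdex w hw (by simp [h1, h2])
    exact ⟨δ, by simp only [hU, Finset.mem_filter, Finset.mem_univ, true_and, hup]; exact
      ⟨hδ, hδ ▸ h⟩⟩
  set T : Finset α := W.filter fun w => 2 ≤ (U w).card with hT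
  have hTZ : ∀ w ∈ T, w ∉ Z₁ ∧ w ∉ Z₂ := by
    intro w hw
    have h2 : 2 ≤ (U w).card := (Finset.mem_filter.1 hw).2
    obtain ⟨δ, hδ⟩ := Finset.card_pos.1 (by omega : 0 < (U w).card)
    simp only [hU, Finset.mem_filter, Finset.mem_univ, true_and] at hδ
    exact hδ.1 ▸ hupZ δ hδ.2
  have hpar : ∀ w, ∃ v, ((U w).card = 1 → ∃ δ, src δ = w ∧ up δ ∧ v = src (r δ)) ∧
      ((U w).card ≠ 1 → v = w) := by
    intro w
    by_cases h1 : (U w).card = 1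
    · obtain ⟨δ, hδ⟩ := Finset.card_pos.1 (by omega : 0 < (U w).card)
      simp only [hU, Finset.mem_filter, Finset.mem_univ, true_and] at hδ
      exact ⟨src (r δ), fun _ => ⟨δ, hδ.1, hδ.2, rfl⟩, fun h => absurd h1 h⟩
    · exact ⟨w, fun h => absurd h h1, fun _ => rfl⟩
  choose par hpar1 hpar2 using hpar
  have hUpos : ∀ δ, up δ → 0 < (U (src δ)).card := fun δ hδ =>
    Finset.card_pos.2 ⟨δ, by simp [hU, hδ]⟩
  have hparup : ∀ δ, up δ → src δ ∉ T → par (src δ) = src (r δ) := by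
    intro δ hδ hδT
    have h1 : (U (src δ)).card = 1 := by
      have := hUpos δ hδ
      simp only [hT, Finset.mem_filter, hsrc, true_and] at hδT
      omega
    obtain ⟨δ', hs, hu, hv⟩ := hpar1 _ h1
    have : δ' = δ := Finset.card_le_one.1 h1.le δ' (by simp [hU, hs, hu]) δ (by simp [hU, hδ])
    rw [hv, this]
  obtain ⟨root, hroot⟩ := exists_root W par d (fun w hw => by
      by_cases h1 : (U w).card = 1
      · obtain ⟨δ, -, -, hv⟩ := hpar1 w h1
        rw [hv]; exact hsrc _
      · rw [hpar2 w h1]; exact hw) (fun w hw hne => by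
      by_cases h1 : (U w).card = 1
      · obtain ⟨δ, hs, hu, hv⟩ := hpar1 w h1
        rw [hv, ← hs]; simp only [hup] at hu; linarith [hlen δ.1]
      · exact absurd (hpar2 w h1) hne)
  have hZU : ∀ w, w ∈ Z₁ ∨ w ∈ Z₂ → U w = ∅ := by
    intro w hw
    rw [Finset.eq_empty_iff_forall_notMem]
    intro δ hδ
    simp only [hU, Finset.mem_filter, Finset.mem_univ, true_and] at hδ
    have := hupZ δ hδ.2
    rw [hδ.1] at this
    tauto
  have hrootfix : ∀ w ∈ W, (U w).card ≠ 1 → root w = w := fun w hw h =>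
    (hroot w hw).2.2.2.2 (hpar2 w h)
  have hrootT : ∀ w ∈ T, root w = w := fun w hw =>
    hrootfix w (Finset.mem_filter.1 hw).1 (by have := (Finset.mem_filter.1 hw).2; omega)
  have hrootZ : ∀ w ∈ W, w ∈ Z₁ ∨ w ∈ Z₂ → root w = w := fun w hw hZ =>
    hrootfix w hw (by simp [hZU w hZ])
  have hrootup : ∀ δ, up δ → src δ ∉ T → root (src δ) = root (src (r δ)) := fun δ h1 h2 => by
    rw [← hparup δ h1 h2, (hroot _ (hsrc δ)).2.2.1]
  -- a small perturbation parameter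
  have hev : ∀ᶠ η in nhdsWithin (0 : ℝ) (Ioi 0), η < 1 ∧ ∀ δ : E × Bool, ∀ w ∈ W,
      η * d w < len δ.1 ∧ (¬ up δ → η * d w < d (src (r δ)) + len δ.1 - d (src δ)) ∧
      ∀ t ∈ bad δ, 0 < t → η * d w < t := by
    have hsmall : ∀ (c k : ℝ), 0 < k → ∀ᶠ η in nhdsWithin (0 : ℝ) (Ioi 0), η * c < k := by
      intro c k hk
      have : Filter.Tendsto (fun η : ℝ => η * c) (nhdsWithin (0 : ℝ) (Ioi 0)) (nhds (0 * c)) :=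
        ((continuous_id.mul continuous_const).tendsto 0).mono_left nhdsWithin_le_nhds
      rw [zero_mul] at this
      exact this.eventually (gt_mem_nhds hk)
    refine Filter.Eventually.and (by simpa using hsmall 1 1 one_pos) ?_
    rw [Filter.eventually_all]
    intro δ
    rw [Filter.eventually_all_finset]
    intro w hw
    refine (hsmall _ _ (hlen _)).and (Filter.Eventually.and ?_ ?_)
    · by_cases hu : up δ
      · exact Filter.Eventually.of_forall fun _ h => absurd hu h
      · have : 0 < d (src (r δ)) + len δ.1 - d (src δ) :=
          sub_pos.2 (lt_of_le_of_ne (hdL δ) hu)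
        filter_upwards [hsmall _ _ this] with η hη _ using hη
    · rw [Filter.eventually_all_finite (hbad δ)]
      intro t _
      by_cases ht : 0 < t
      · filter_upwards [hsmall _ _ ht] with η hη _ using hη
      · exact Filter.Eventually.of_forall fun _ h => absurd h ht
  obtain ⟨η, ⟨hη1, hη⟩, hη0⟩ := (hev.and self_mem_nhdsWithin).exists
  have hη0 : 0 < η := hη0
  set h : α → ℝ := fun w => -d w + η * d (root w) with hh
  have hβ : ∀ w ∈ W, 0 ≤ η * d (root w) ∧ η * d (root w) ≤ η * d w := fun w hw =>
    ⟨mul_nonneg hη0.le (hd0 _ (hroot w hw).1),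
      mul_le_mul_of_nonneg_left (hroot w hw).2.2.2.1 hη0.le⟩
  have hhZ : ∀ w, w ∈ Z₁ ∨ w ∈ Z₂ → h w = 0 := by
    intro w hw
    have hwW : w ∈ W := hw.elim (fun h => hZW₁ h) (fun h => hZW₂ h)
    have hdw : d w = 0 := hw.elim (hdZ₁ w) (hdZ₂ w)
    simp [hh, hrootZ w hwW hw, hdw]
  -- height differences along darts
  have htight : ∀ δ, up δ → src δ ∉ T → h (src (r δ)) = h (src δ) + len δ.1 := by
    intro δ h1 h2
    simp only [hh, hrootup δ h1 h2]
    simp only [hup] at h1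
    linarith
  have hflag : ∀ δ, up δ → src δ ∈ T → h (src δ) < h (src (r δ)) ∧
      h (src (r δ)) < h (src δ) + len δ.1 ∧
      ∀ t ∈ bad δ, 0 < t → h (src δ) + len δ.1 - h (src (r δ)) < t := by
    intro δ h1 h2
    have h3 := hβ _ (hsrc δ)
    have h4 := hβ _ (hsrc (r δ))
    have h5 := hη δ _ (hsrc δ)
    simp only [hh, hrootT _ h2]
    simp only [hup] at h1
    have h6 : η * d (src δ) = η * d (src (r δ)) + η * len δ.1 := by rw [h1]; ring
    have h7 := mul_pos hη0 (hlen δ.1)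
    refine ⟨by linarith [h5.1], by linarith, fun t ht ht0 => ?_⟩
    linarith [h5.2.2 t ht ht0]
  have hnup : ∀ δ, ¬ up δ → h (src (r δ)) < h (src δ) + len δ.1 := by
    intro δ h1
    have h3 := hβ _ (hsrc δ)
    have h4 := hβ _ (hsrc (r δ))
    have h5 := (hη δ _ (hsrc (r δ))).2.1 h1
    simp only [hh]
    linarith
  have hupl : ∀ δ, up δ → h (src δ) < h (src (r δ)) := fun δ h1 => by
    by_cases h2 : src δ ∈ T
    · exact (hflag δ h1 h2).1
    · rw [htight δ h1 h2]; linarith [hlen δ.1]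
  -- the chosen darts at the flagged vertices
  have hch : ∀ w, ∃ S : Finset (E × Bool), S ⊆ U w ∧ (w ∈ T → S.card = 2) := by
    intro w
    by_cases hw : w ∈ T
    · obtain ⟨S, hS, hS2⟩ := Finset.exists_subset_card_eq (Finset.mem_filter.1 hw).2
      exact ⟨S, hS, fun _ => hS2⟩
    · exact ⟨∅, by simp, fun h => absurd h hw⟩
  choose S hSU hS2 using hch
  set tight : E × Bool → Prop := fun δ => up δ ∧ src δ ∉ T with htightdef
  set des : E × Bool → Prop := fun δ => src δ ∈ T ∧ δ ∈ S (src δ) with hdes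
  have hdesup : ∀ δ, des δ → up δ := fun δ hδ => by
    have := hSU _ hδ.2
    simp only [hU, Finset.mem_filter] at this
    exact this.2.2
  set F : Set E := F₁ ∪ F₂ with hF
  have hFZ : ∀ δ, δ.1 ∈ F → src δ ∈ Z₁ ∨ src δ ∈ Z₂ := fun δ hδ =>
    hδ.imp (hF₁ δ) (hF₂ δ)
  have hFup : ∀ δ, δ.1 ∈ F → ¬ up δ := fun δ h1 h2 => by
    have := hupZ δ h2
    have := hFZ δ h1
    tauto
  set spec : E → Prop := fun e => e ∈ F ∨ ∃ b, tight (e, b) ∨ des (e, b) with hspec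
  have hgen : ∀ e, ∃ g : ℝ, ¬ spec e →
      (∀ b, g < h (src (e, b))) ∧ h (src (e, true)) + h (src (e, false)) - 2 * g < len e ∧
      ∀ b, h (src (e, b)) - g ∉ bad (e, b) := by
    intro e
    by_cases he : spec e
    · exact ⟨0, fun h => absurd he h⟩
    have hlt : ∀ δ : E × Bool, δ.1 = e → h (src (r δ)) < h (src δ) + len e := by
      intro δ hδ
      by_cases h1 : up δ
      · by_cases h2 : src δ ∈ T
        · rw [← hδ]; exact (hflag δ h1 h2).2.1
        · exact absurd (Or.inr ⟨δ.2, Or.inl (by rw [← hδ]; exact ⟨h1, h2⟩)⟩) he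
      · rw [← hδ]; exact hnup δ h1
    have e1 := hlt (e, true) rfl
    have e2 := hlt (e, false) rfl
    simp only [hr, Bool.not_true, Bool.not_false] at e1 e2
    have hlt' : (h (src (e, true)) + h (src (e, false)) - len e) / 2 <
        min (h (src (e, true))) (h (src (e, false))) := by
      rw [lt_min_iff]; constructor <;> linarith
    have hfin : (⋃ b, (fun g => h (src (e, b)) - g) ⁻¹' bad (e, b)).Finite :=
      Set.finite_iUnion fun b => (hbad _).preimage (fun x _ y _ hxy => by simpa using hxy)
    obtain ⟨g, hg, hg'⟩ := ((Set.Ioo_infinite hlt').sdiff hfin).nonempty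
    simp only [mem_iUnion, mem_preimage, not_exists] at hg'
    have hg2 := lt_min_iff.1 hg.2
    refine ⟨g, fun _ => ⟨fun b => ?_, by linarith [hg.1], hg'⟩⟩
    cases b
    · exact hg2.2
    · exact hg2.1
  choose g hg using hgen
  set m : E → ℝ := fun e => if spec e then min (h (src (e, true))) (h (src (e, false))) else g e
    with hm
  have hmspec : ∀ δ, spec δ.1 → m δ.1 = min (h (src δ)) (h (src (r δ))) := by
    rintro ⟨e, b⟩ he
    cases b
    · simp only [hm, if_pos he, hr, Bool.not_false, min_comm]
    · simp only [hm, if_pos he, hr, Bool.not_true]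
  set τ : E × Bool → ℝ := fun δ => h (src δ) - m δ.1 with hτ
  -- the values of `τ` on the four kinds of edges
  have τF : ∀ δ, δ.1 ∈ F → τ δ = 0 := by
    intro δ hδ
    simp only [hτ, hmspec δ (Or.inl hδ), hhZ _ (hFZ δ hδ), hhZ _ (hFZ (r δ) hδ)]
    simp
  have specup : ∀ δ, tight δ ∨ des δ → spec δ.1 := fun δ hδ => Or.inr ⟨δ.2, hδ⟩
  have τup : ∀ δ, tight δ ∨ des δ → τ δ = 0 ∧ τ (r δ) = h (src (r δ)) - h (src δ) := by
    intro δ hδ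
    have h1 := hupl δ (hδ.elim (fun h => h.1) (hdesup δ))
    simp only [hτ, hr1, hmspec δ (specup δ hδ), min_eq_left h1.le]
    simp
  have τtight : ∀ δ, tight δ → τ δ = 0 ∧ τ (r δ) = len δ.1 := fun δ hδ => by
    have h1 := τup δ (Or.inl hδ)
    have h2 := htight δ hδ.1 hδ.2
    exact ⟨h1.1, by linarith [h1.2]⟩
  have τdes : ∀ δ, des δ → τ δ = 0 ∧ 0 < τ (r δ) ∧ τ (r δ) < len δ.1 := fun δ hδ => by
    have h1 := τup δ (Or.inr hδ)
    have h2 := hflag δ (hdesup δ hδ) hδ.1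
    exact ⟨h1.1, by linarith [h1.2, h2.1], by linarith [h1.2, h2.2.1]⟩
  have τgen : ∀ δ, ¬ spec δ.1 → 0 < τ δ ∧ 0 < τ (r δ) ∧ τ δ + τ (r δ) < len δ.1 ∧
      τ δ ∉ bad δ := by
    rintro ⟨e, b⟩ he
    obtain ⟨g1, g2, g3⟩ := hg e he
    have hme : m e = g e := if_neg he
    simp only [hτ, hr, hme]
    refine ⟨by linarith [g1 b], by linarith [g1 (!b)], ?_, g3 b⟩
    cases b
    · simp only [Bool.not_false]; linarith
    · simp only [Bool.not_true]; linarith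
  have hcases : ∀ δ : E × Bool, δ.1 ∈ F ∨ (tight δ ∨ tight (r δ)) ∨ (des δ ∨ des (r δ)) ∨
      ¬ spec δ.1 := by
    rintro ⟨e, b⟩
    by_cases he : spec e
    · rcases he with he | ⟨b', hb'⟩
      · exact Or.inl he
      · rcases Bool.eq_or_eq_not b' b with rfl | rfl
        · tauto
        · tauto
    · exact Or.inr (Or.inr (Or.inr he))
  set c : E × Bool → ℤ := fun δ =>
    (if τ δ = 0 then 1 else 0) + (if τ (r δ) = len δ.1 then 1 else 0) with hc
  have cF : ∀ δ, δ.1 ∈ F → c δ = 1 := fun δ hδ => by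
    simp [hc, τF δ hδ, τF (r δ) hδ, (hlen δ.1).ne]
  have ctight : ∀ δ, tight δ → c δ = 2 ∧ c (r δ) = 0 := fun δ hδ => by
    have h1 := τtight δ hδ
    simp [hc, h1.1, h1.2, hrr, hr1, (hlen δ.1).ne, (hlen δ.1).ne']
  have cdes : ∀ δ, des δ → c δ = 1 ∧ c (r δ) = 0 := fun δ hδ => by
    have h1 := τdes δ hδ
    simp [hc, h1.1, h1.2.1.ne', h1.2.2.ne, hrr, hr1, (hlen δ.1).ne]
  have cgen : ∀ δ, ¬ spec δ.1 → c δ = 0 := fun δ hδ => by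
    have h1 := τgen δ hδ
    have h2 : τ (r δ) ≠ len δ.1 := by linarith [h1.1, h1.2.2.1] |> fun h : τ (r δ) < len δ.1 => h.ne
    simp [hc, h1.1.ne', h2]
  have hcval : ∀ δ, c δ = if δ.1 ∈ F then 1 else if tight δ then 2 else if des δ then 1 else 0 := by
    intro δ
    by_cases h1 : δ.1 ∈ F
    · rw [if_pos h1, cF δ h1]
    rw [if_neg h1]
    by_cases h2 : tight δ
    · rw [if_pos h2, (ctight δ h2).1]
    rw [if_neg h2]
    by_cases h3 : des δ
    · rw [if_pos h3, (cdes δ h3).1]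
    rw [if_neg h3]
    rcases hcases δ with h | (h | h) | (h | h) | h
    · exact absurd h h1
    · exact absurd h h2
    · simpa [hrr] using (ctight _ h).2
    · exact absurd h h3
    · simpa [hrr] using (cdes _ h).2
    · exact cgen δ h
  have hndes : ∀ δ, ¬ up δ → ¬ des δ := fun δ h1 h2 => h1 (hdesup δ h2)
  have hsum : ∀ w ∈ W, ∑ δ with src δ = w, c δ = 2 := by
    intro w hw
    by_cases hZ1 : w ∈ Z₁
    · have : ∀ δ ∈ Finset.univ.filter (fun δ => src δ = w), c δ = if δ.1 ∈ F₁ then 1 else 0 := by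
        intro δ hδ
        have hδ : src δ = w := by simpa using hδ
        have hu : ¬ up δ := fun hu => (hupZ δ hu).1 (hδ ▸ hZ1)
        rw [hcval, if_neg (fun h : tight δ => hu h.1), if_neg (hndes δ hu)]
        have : δ.1 ∉ F₂ := fun h => hdisjZ w hZ1 (hδ ▸ hF₂ δ h)
        simp [hF, this]
      rw [Finset.sum_congr rfl this, Finset.sum_boole, Finset.filter_filter, hc₁ w hZ1]
      rfl
    by_cases hZ2 : w ∈ Z₂
    · have : ∀ δ ∈ Finset.univ.filter (fun δ => src δ = w), c δ = if δ.1 ∈ F₂ then 1 else 0 := by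
        intro δ hδ
        have hδ : src δ = w := by simpa using hδ
        have hu : ¬ up δ := fun hu => (hupZ δ hu).2 (hδ ▸ hZ2)
        rw [hcval, if_neg (fun h : tight δ => hu h.1), if_neg (hndes δ hu)]
        have : δ.1 ∉ F₁ := fun h => hZ1 (hδ ▸ hF₁ δ h)
        simp [hF, this]
      rw [Finset.sum_congr rfl this, Finset.sum_boole, Finset.filter_filter, hc₂ w hZ2]
      rfl
    have hnF : ∀ δ, src δ = w → δ.1 ∉ F := fun δ hδ h => by
      have := hFZ δ h
      rw [hδ] at this
      tauto
    by_cases hwT : w ∈ T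
    · have : ∀ δ ∈ Finset.univ.filter (fun δ => src δ = w), c δ = if δ ∈ S w then 1 else 0 := by
        intro δ hδ
        have hδ : src δ = w := by simpa using hδ
        rw [hcval, if_neg (hnF δ hδ), if_neg (fun h : tight δ => h.2 (hδ ▸ hwT))]
        simp [hdes, hδ, hwT]
      rw [Finset.sum_congr rfl this, Finset.sum_boole, Finset.filter_filter]
      have : Finset.univ.filter (fun δ => src δ = w ∧ δ ∈ S w) = S w := by
        ext δ
        simp only [Finset.mem_filter, Finset.mem_univ, true_and, and_iff_right_iff_imp]
        intro hδ
        have := hSU w hδ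
        simp only [hU, Finset.mem_filter] at this
        exact this.2.1
      rw [this, hS2 w hwT]
      rfl
    · have : ∀ δ ∈ Finset.univ.filter (fun δ => src δ = w), c δ = 2 * if up δ then 1 else 0 := by
        intro δ hδ
        have hδ : src δ = w := by simpa using hδ
        rw [hcval, if_neg (hnF δ hδ), if_neg (fun h : des δ => hwT (hδ ▸ h.1))]
        simp [htightdef, hδ, hwT]
      rw [Finset.sum_congr rfl this, ← Finset.mul_sum, Finset.sum_boole, Finset.filter_filter]
      have h1 : (U w).card = 1 := by
        have := Finset.card_pos.2 (hUne w hw hZ1 hZ2)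
        simp only [hT, Finset.mem_filter, hw, true_and] at hwT
        omega
      change 2 * (((U w).card : ℕ) : ℤ) = 2
      rw [h1]; rfl
  have hsumdes : ∑ δ, (if des δ then 1 else 0 : ℤ) = 2 * T.card := by
    rw [← Finset.sum_fiberwise_of_maps_to (s := Finset.univ) (t := W) (g := src)
      (fun δ _ => hsrc δ)]
    have : ∀ w ∈ W, ∑ δ with src δ = w, (if des δ then 1 else 0 : ℤ) = if w ∈ T then 2 else 0 := by
      intro w _
      rw [Finset.sum_boole, Finset.filter_filter]
      by_cases hwT : w ∈ T
      · rw [if_pos hwT]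
        have : Finset.univ.filter (fun δ => src δ = w ∧ des δ) = S w := by
          ext δ
          simp only [Finset.mem_filter, Finset.mem_univ, true_and, hdes]
          constructor
          · rintro ⟨rfl, -, h⟩; exact h
          · intro hδ
            have := hSU w hδ
            simp only [hU, Finset.mem_filter] at this
            obtain rfl := this.2.1
            exact ⟨rfl, hwT, hδ⟩
        rw [this, hS2 w hwT]; rfl
      · rw [if_neg hwT, Finset.filter_false_of_mem]
        · simp
        · rintro δ - ⟨rfl, h⟩; exact hwT h.1
    rw [Finset.sum_congr rfl this, ← Finset.sum_filter, Finset.sum_const,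
      Finset.filter_mem_eq_inter, Finset.inter_eq_right.2 (Finset.filter_subset _ _)]
    rw [← hT]
    simp [mul_comm]
  have hsumc : ∑ δ, c δ = 2 * W.card := by
    rw [← Finset.sum_fiberwise_of_maps_to (s := Finset.univ) (t := W) (g := src)
      (fun δ _ => hsrc δ), Finset.sum_congr rfl hsum]
    simp [mul_comm]
  have hedge : ∀ e : E, (c (e, true) + if des (e, true) then 1 else 0) +
      (c (e, false) + if des (e, false) then 1 else 0) =
      2 - 2 * if (∀ b, 0 < τ (e, b)) then 1 else 0 := by
    intro e
    have key : ∀ b, (c (e, b) + if des (e, b) then 1 else 0) +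
        (c (r (e, b)) + if des (r (e, b)) then 1 else 0) =
        2 - 2 * if (0 < τ (e, b) ∧ 0 < τ (r (e, b))) then 1 else 0 := by
      intro b
      have hF' : e ∈ F → ∀ δ : E × Bool, δ.1 = e → c δ = 1 ∧ ¬ des δ ∧ τ δ = 0 := by
        rintro he δ rfl
        exact ⟨cF δ he, hndes _ (hFup δ he), τF δ he⟩
      have htight' : ∀ δ, tight δ → c δ = 2 ∧ c (r δ) = 0 ∧ ¬ des δ ∧ ¬ des (r δ) ∧ τ δ = 0 :=
        fun δ h => ⟨(ctight δ h).1, (ctight δ h).2, fun h' => h.2 h'.1,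
          hndes _ (hupr δ h.1), (τtight δ h).1⟩
      have hdes' : ∀ δ, des δ → c δ = 1 ∧ c (r δ) = 0 ∧ ¬ des (r δ) ∧ τ δ = 0 :=
        fun δ h => ⟨(cdes δ h).1, (cdes δ h).2, hndes _ (hupr δ (hdesup δ h)), (τdes δ h).1⟩
      rcases hcases (e, b) with h | (h | h) | (h | h) | h
      · obtain ⟨h1, h2, h3⟩ := hF' h (e, b) rfl
        obtain ⟨h4, h5, h6⟩ := hF' h (r (e, b)) rfl
        simp [h1, h2, h3, h4, h5]
      · obtain ⟨h1, h2, h3, h4, h5⟩ := htight' _ h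
        simp [h1, h2, h3, h4, h5]
      · obtain ⟨h1, h2, h3, h4, h5⟩ := htight' _ h
        rw [hrr] at h2 h4
        simp [h1, h2, h3, h4, h5]
      · obtain ⟨h1, h2, h3, h4⟩ := hdes' _ h
        simp [h1, h2, h3, h4, h]
      · obtain ⟨h1, h2, h3, h4⟩ := hdes' _ h
        rw [hrr] at h2 h3
        simp [h1, h2, h3, h4, h]
      · have h1 := τgen _ h
        have hd : ∀ δ : E × Bool, δ.1 = e → ¬ des δ :=
          fun δ hδ hdδ => h (hδ ▸ specup δ (Or.inr hdδ))
        rw [cgen _ h, cgen (r (e, b)) h, if_neg (hd _ rfl), if_neg (hd _ rfl),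
          if_pos ⟨h1.1, h1.2.1⟩]
        rfl
    have := key true
    simp only [hr, Bool.not_true] at this
    simp only [this, Bool.forall_bool, and_comm]
  have hcount : (T.card : ℤ) + (Finset.univ.filter fun e : E => ∀ b, 0 < τ (e, b)).card =
      Fintype.card E - W.card := by
    have h1 : ∑ δ, (c δ + if des δ then 1 else 0) = 2 * W.card + 2 * T.card := by
      rw [Finset.sum_add_distrib, hsumc, hsumdes]
    rw [Fintype.sum_prod_type] at h1
    simp only [Fintype.sum_bool, hedge] at h1
    rw [Finset.sum_sub_distrib, ← Finset.mul_sum, Finset.sum_boole] at h1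
    simp only [Finset.sum_const, Finset.card_univ, nsmul_eq_mul] at h1
    linarith
  set lab : α → α ⊕ Bool := fun w => if root w ∈ Z₁ then Sum.inr true else
    if root w ∈ Z₂ then Sum.inr false else Sum.inl (root w) with hlab
  have labZ₁ : ∀ w ∈ Z₁, lab w = Sum.inr true := fun w hw => by
    simp [hlab, hrootZ w (hZW₁ hw) (Or.inl hw), hw]
  have labZ₂ : ∀ w ∈ Z₂, lab w = Sum.inr false := fun w hw => by
    have : w ∉ Z₁ := fun h => hdisjZ w h hw
    simp [hlab, hrootZ w (hZW₂ hw) (Or.inr hw), hw, this]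
  have labT : ∀ w ∈ T, lab w = Sum.inl w := fun w hw => by
    simp [hlab, hrootT w hw, hTZ w hw]
  have labup : ∀ δ, tight δ → lab (src δ) = lab (src (r δ)) := fun δ hδ => by
    simp only [hlab, hrootup δ hδ.1 hδ.2]
  have labcard : T.card + 2 ≤ (W.image lab).card := by
    have : (T.disjSum (Finset.univ : Finset Bool)) ⊆ W.image lab := by
      intro x hx
      rw [Finset.mem_image]
      rcases x with x | b
      · have hx : x ∈ T := by simpa using hx
        exact ⟨x, (Finset.mem_filter.1 hx).1, labT x hx⟩
      · cases b
        · obtain ⟨z, hz⟩ := hZ₂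
          exact ⟨z, hZW₂ hz, labZ₂ z hz⟩
        · obtain ⟨z, hz⟩ := hZ₁
          exact ⟨z, hZW₁ hz, labZ₁ z hz⟩
    simpa using Finset.card_le_card this
  have τcases : ∀ δ, 0 ≤ τ δ ∧ τ δ + τ (r δ) ≤ len δ.1 ∧
      (τ δ + τ (r δ) = len δ.1 → τ δ = 0 ∨ τ (r δ) = 0) ∧
      (0 < τ δ → τ δ < len δ.1 → τ δ ∉ bad δ) ∧
      (τ δ = 0 → (τ (r δ) = 0 ∨ τ (r δ) = len δ.1) → lab (src δ) = lab (src (r δ))) := by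
    intro δ
    rcases hcases δ with h | (h | h) | (h | h) | h
    · have h1 := τF δ h
      have h2 := τF (r δ) h
      refine ⟨h1.ge, by rw [h1, h2]; simpa using (hlen δ.1).le, fun _ => Or.inl h1,
        fun h3 => absurd h1 h3.ne', fun _ _ => ?_⟩
      rcases h with h | h
      · rw [labZ₁ _ (hF₁ δ h), labZ₁ _ (hF₁ (r δ) h)]
      · rw [labZ₂ _ (hF₂ δ h), labZ₂ _ (hF₂ (r δ) h)]
    · obtain ⟨h1, h2⟩ := τtight δ h
      exact ⟨h1.ge, by rw [h1, h2, zero_add], fun _ => Or.inl h1, fun h3 => absurd h1 h3.ne',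
        fun _ _ => labup δ h⟩
    · obtain ⟨h1, h2⟩ := τtight _ h
      rw [hrr, hr1] at h2
      exact ⟨h2 ▸ (hlen _).le, by rw [h1, h2, add_zero], fun _ => Or.inr h1,
        fun _ h4 => absurd h2 h4.ne, fun h3 => absurd (h3.symm.trans h2) (hlen _).ne⟩
    · obtain ⟨h1, h2, h3⟩ := τdes δ h
      exact ⟨h1.ge, by rw [h1, zero_add]; exact h3.le, fun _ => Or.inl h1,
        fun h3 => absurd h1 h3.ne', fun _ h4 => (h4.elim h2.ne' h3.ne).elim⟩
    · obtain ⟨h1, h2, h3⟩ := τdes _ h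
      rw [hrr] at h2 h3
      refine ⟨h2.le, by rw [h1, add_zero]; exact h3.le, fun _ => Or.inr h1, fun _ _ hb => ?_,
        fun h4 => absurd h4 h2.ne'⟩
      have h5 := (τup _ (Or.inr h)).2
      have h6 := (hflag _ (hdesup _ h) h.1).2.2 (len δ.1 - τ δ)
        (hbads (r δ) _ (by change τ δ ∈ bad (r (r δ)); rw [hrr]; exact hb)) (by
          rw [hr1] at h3; linarith)
      rw [hrr] at h5 h6
      rw [hr1] at h6
      linarith
    · obtain ⟨h1, h2, h3, h4⟩ := τgen δ h
      exact ⟨h1.le, h3.le, fun h5 => absurd h5 h3.ne, fun _ _ => h4, fun h5 => absurd h5 h1.ne'⟩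
  refine ⟨h, τ, lab, fun δ => (τcases δ).1, fun δ => (τcases δ).2.1, fun δ => ?_, hsum,
    fun δ => (τcases δ).2.2.1, fun δ => (τcases δ).2.2.2.1, fun δ => (τcases δ).2.2.2.2, ?_⟩
  · simp only [hτ]; ring
  · omega

/-! ### Local structure at a point -/

/-- A metric star at `x` of radius `r`: unit speed paths `σ j` from `x` with disjoint interiors
which cover the ball of radius `r`. -/
structure MStar {J : Type*} (x : G) (σ : J → ℝ → G) (r : ℝ) : Prop where
  pos : 0 < r
  unit : ∀ j, IsUnitSpeedFrom x r (σ j)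
  inj : ∀ i j, ∀ s ∈ Ioo 0 r, ∀ t ∈ Ioo 0 r, σ i s = σ j t → i = j
  cover : ∀ y, dist x y < r → y = x ∨ ∃ j, σ j (dist x y) = y

open Topology in
/-- A topological star of `C` at `x`: paths `c i` from `x` with disjoint interiors which cover
a neighbourhood of `x` in `C`. -/
structure TStar {I : Type*} (C : Set G) (x : G) (c : I → ℝ → G) (ε : ℝ) : Prop where
  pos : 0 < ε
  cont : ∀ i, Continuous (c i)
  zero : ∀ i, c i 0 = x
  mem : ∀ i, ∀ t ∈ Ioo 0 ε, c i t ∈ C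
  ne : ∀ i, ∀ t ∈ Ioo 0 ε, c i t ≠ x
  inj : ∀ i j, ∀ s ∈ Ioo 0 ε, ∀ t ∈ Ioo 0 ε, c i s = c j t → i = j
  nhds : ∀ η, 0 < η → η ≤ ε → ∃ N ∈ 𝓝 x, ∀ y ∈ N, y ∈ C → y = x ∨ ∃ i, ∃ t ∈ Ioo 0 η, c i t = y

open Topology in
theorem eventually_Ioo_of_gt {P : ℝ → Prop} :
    (∀ᶠ t in 𝓝[>] (0 : ℝ), P t) ↔ ∃ δ > 0, ∀ t ∈ Ioo 0 δ, P t := by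
  rw [Filter.Eventually, mem_nhdsGT_iff_exists_Ioo_subset]
  rfl

namespace MStar

open Topology

variable {J : Type*} {x : G} {σ : J → ℝ → G} {r : ℝ}

theorem dist_eq (h : MStar x σ r) (j : J) {t : ℝ} (ht : t ∈ Ico 0 r) : dist x (σ j t) = t := by
  have := (h.unit j).2 0 ⟨le_rfl, h.pos⟩ t ht
  rwa [(h.unit j).1, zero_sub, abs_neg, abs_of_nonneg ht.1] at this

theorem continuousOn (h : MStar x σ r) (j : J) : ContinuousOn (σ j) (Ico 0 r) := by
  refine Metric.continuousOn_iff.2 fun b hb ε hε => ⟨ε, hε, fun a ha hab => ?_⟩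
  rwa [(h.unit j).2 a ha b hb]

theorem continuousAt (h : MStar x σ r) (j : J) {t : ℝ} (ht : t ∈ Ioo 0 r) :
    ContinuousAt (σ j) t :=
  (h.continuousOn j).continuousAt (Ico_mem_nhds ht.1 ht.2)

/-- A property holds near `x` as soon as it holds at `x` and along every branch. -/
theorem eventually [Finite J] (h : MStar x σ r) {P : G → Prop} (hx : P x)
    (hP : ∀ j, ∀ᶠ t in 𝓝[>] (0 : ℝ), P (σ j t)) : ∀ᶠ y in 𝓝 x, P y := by
  obtain ⟨δ, hδ, hPδ⟩ := eventually_Ioo_of_gt.1 (Filter.eventually_all.2 hP)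
  refine Metric.eventually_nhds_iff.2 ⟨min δ r, lt_min hδ h.pos, fun y hy => ?_⟩
  rw [dist_comm] at hy
  rcases h.cover y (hy.trans_le (min_le_right _ _)) with rfl | ⟨j, hj⟩
  · exact hx
  · by_cases hyx : y = x
    · rwa [hyx]
    · rw [← hj]
      exact hPδ _ ⟨dist_pos.2 (Ne.symm hyx), hy.trans_le (min_le_left _ _)⟩ j

theorem isOpen_branch [Finite J] (h : MStar x σ r) (j : J) : IsOpen (σ j '' Ioo 0 r) := by
  rw [isOpen_iff_mem_nhds]
  rintro _ ⟨t, ht, rfl⟩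
  have hd : dist x (σ j t) = t := h.dist_eq j ⟨ht.1.le, ht.2⟩
  have h1 : ∀ᶠ u in 𝓝 (σ j t), dist x u ∈ Ioo 0 r := by
    have : Filter.Tendsto (fun u => dist x u) (𝓝 (σ j t)) (𝓝 t) := by
      have := (continuous_const.dist continuous_id : Continuous fun u => dist x u).tendsto (σ j t)
      rwa [hd] at this
    exact this.eventually (Ioo_mem_nhds ht.1 ht.2)
  have h2 : ∀ᶠ u in 𝓝 (σ j t), ∀ i, i ≠ j → σ i (dist x u) ≠ u := by
    refine Filter.eventually_all.2 fun i => ?_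
    by_cases hij : i = j
    · simp [hij]
    · have hc : ContinuousAt (fun u => σ i (dist x u)) (σ j t) := by
        refine ContinuousAt.comp (g := σ i) ?_ (by fun_prop)
        rw [hd]
        exact h.continuousAt i ht
      have hne : 0 < dist (σ i (dist x (σ j t))) (σ j t) :=
        dist_pos.2 fun he => hij (h.inj i j t ht t ht (by rwa [hd] at he))
      filter_upwards [(hc.dist continuousAt_id).eventually_const_lt hne] with u hu _
      exact dist_pos.1 hu
  filter_upwards [h1, h2] with u hu1 hu2
  rcases h.cover u hu1.2 with rfl | ⟨i, hi⟩
  · simp at hu1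
  · have : i = j := by
      by_contra hij
      exact hu2 i hij hi
    exact ⟨_, hu1, this ▸ hi⟩

theorem subset_branch [Finite J] (h : MStar x σ r) {C : Set G} (hC : IsPreconnected C)
    (hCr : ∀ y ∈ C, dist x y < r) (hxC : x ∉ C) (hne : C.Nonempty) :
    ∃ j, C ⊆ σ j '' Ioo 0 r := by
  obtain ⟨y, hy⟩ := hne
  have hcov : ∀ y ∈ C, ∃ j, y ∈ σ j '' Ioo 0 r := by
    intro y hy
    have hyx : x ≠ y := fun hyx => hxC (hyx ▸ hy)
    rcases h.cover y (hCr y hy) with h1 | ⟨j, hj⟩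
    · exact absurd h1.symm hyx
    · exact ⟨j, _, ⟨dist_pos.2 hyx, hCr y hy⟩, hj⟩
  obtain ⟨j, hj⟩ := hcov y hy
  refine ⟨j, ?_⟩
  refine hC.subset_left_of_subset_union (v := ⋃ i ∈ {i | i ≠ j}, σ i '' Ioo 0 r)
    (h.isOpen_branch j) (isOpen_biUnion fun i _ => h.isOpen_branch i) ?_ ?_ ⟨y, hy, hj⟩
  · rw [Set.disjoint_left]
    rintro _ ⟨s, hs, rfl⟩ hm
    obtain ⟨i, hi, t, ht, hit⟩ := mem_iUnion₂.1 hm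
    exact hi (h.inj _ _ t ht s hs hit)
  · intro z hz
    obtain ⟨i, hi⟩ := hcov z hz
    by_cases hij : i = j
    · exact Or.inl (hij ▸ hi)
    · exact Or.inr (mem_iUnion₂.2 ⟨i, hij, hi⟩)

theorem exists_eq [Finite J] (h : MStar x σ r) {ε : ℝ} (hε : 0 < ε) {γ : ℝ → G}
    (hγ : IsUnitSpeedFrom x ε γ) : ∃ j, ∃ δ > 0, ∀ t ∈ Ico 0 δ, γ t = σ j t := by
  have hm : 0 < min ε r := lt_min hε h.pos
  have hd : ∀ t ∈ Ico 0 ε, dist x (γ t) = t := fun t ht => by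
    have := hγ.2 0 ⟨le_rfl, hε⟩ t ht
    rwa [hγ.1, zero_sub, abs_neg, abs_of_nonneg ht.1] at this
  have hsub : ∀ t ∈ Ioo 0 (min ε r), t ∈ Ico 0 ε :=
    fun t ht => ⟨ht.1.le, ht.2.trans_le (min_le_left _ _)⟩
  have hcont : ContinuousOn γ (Ioo 0 (min ε r)) := by
    refine Metric.continuousOn_iff.2 fun b hb ε' hε' => ⟨ε', hε', fun a ha hab => ?_⟩
    rwa [hγ.2 a (hsub a ha) b (hsub b hb)]
  obtain ⟨j, hj⟩ := h.subset_branch (isPreconnected_Ioo.image _ hcont)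
    (by
      rintro _ ⟨t, ht, rfl⟩
      rw [hd t (hsub t ht)]
      exact ht.2.trans_le (min_le_right _ _))
    (by
      rintro ⟨t, ht, htx⟩
      have := hd t (hsub t ht)
      rw [htx, dist_self] at this
      exact ht.1.ne this)
    ((nonempty_Ioo.2 hm).image _)
  refine ⟨j, min ε r, hm, fun t ht => ?_⟩
  rcases ht.1.eq_or_lt with rfl | h0
  · rw [hγ.1, (h.unit j).1]
  · obtain ⟨s, hs, hst⟩ := hj ⟨t, ⟨h0, ht.2⟩, rfl⟩
    have h1 := h.dist_eq j ⟨hs.1.le, hs.2⟩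
    rw [hst, hd t (hsub t ⟨h0, ht.2⟩)] at h1
    rw [← hst, ← h1]

theorem hasSlopeAlong [Finite J] (h : MStar x σ r) {f : G → ℝ} {s : J → ℤ}
    (hs : ∀ j, HasSlopeAlong f (σ j) (s j)) {ε : ℝ} (hε : 0 < ε) {γ : ℝ → G}
    (hγ : IsUnitSpeedFrom x ε γ) : ∃ k : ℤ, HasSlopeAlong f γ k := by
  obtain ⟨j, δ, hδ, hj⟩ := h.exists_eq hε hγ
  obtain ⟨δ', hδ', hs'⟩ := hs j
  refine ⟨s j, min δ δ', lt_min hδ hδ', fun t ht => ?_⟩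
  rw [hj t ⟨ht.1, ht.2.trans_le (min_le_left _ _)⟩, hj 0 ⟨le_rfl, hδ⟩]
  exact hs' t ⟨ht.1, ht.2.trans_le (min_le_right _ _)⟩

theorem ordAt_eq [Fintype J] (h : MStar x σ r) {f : G → ℝ} {s : J → ℤ}
    (hs : ∀ j, HasSlopeAlong f (σ j) (s j)) : ordAt f x = ∑ j, s j := by
  let ζ : J → TangentDir x := fun j => Quotient.mk (germSetoid x) ⟨σ j, r, h.pos, h.unit j⟩
  have hζ : Bijective ζ := by
    constructor
    · intro i j hij
      obtain ⟨δ, hδ, hij⟩ := Quotient.exact hij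
      have hm : 0 < min δ r := lt_min hδ h.pos
      have h1 : min δ r / 2 < min δ r := half_lt_self hm
      have h2 : min δ r / 2 ∈ Ioo 0 r := ⟨half_pos hm, h1.trans_le (min_le_right _ _)⟩
      exact h.inj i j _ h2 _ h2 (hij _ ⟨h2.1.le, h1.trans_le (min_le_left _ _)⟩)
    · intro z
      obtain ⟨⟨γ, ε, hε, hγ⟩, rfl⟩ := Quotient.exists_rep z
      obtain ⟨j, δ, hδ, hj⟩ := h.exists_eq hε hγ
      exact ⟨j, Quotient.sound ⟨δ, hδ, fun t ht => (hj t ht).symm⟩⟩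
  have hts : ∀ j, tangentSlope f (ζ j) = s j := by
    intro j
    obtain ⟨δ, hδ, hj⟩ : (germSetoid x).r (Quotient.out (ζ j)) ⟨σ j, r, h.pos, h.unit j⟩ :=
      Quotient.exact (Quotient.out_eq (ζ j))
    obtain ⟨δ', hδ', hs'⟩ := hs j
    have hm : 0 < min δ δ' := lt_min hδ hδ'
    have hex : HasSlopeAlong f (Quotient.out (ζ j)).1 (s j) := by
      refine ⟨min δ δ', hm, fun t ht => ?_⟩
      rw [hj t ⟨ht.1, ht.2.trans_le (min_le_left _ _)⟩, hj 0 ⟨le_rfl, hδ⟩]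
      exact hs' t ⟨ht.1, ht.2.trans_le (min_le_right _ _)⟩
    have hex' : ∃ k : ℤ, HasSlopeAlong f (Quotient.out (ζ j)).1 k := ⟨_, hex⟩
    rw [tangentSlope, dif_pos hex']
    obtain ⟨δ₁, hδ₁, h₁⟩ := hex'.choose_spec
    obtain ⟨δ₂, hδ₂, h₂⟩ := hex
    have hm' : 0 < min δ₁ δ₂ := lt_min hδ₁ hδ₂
    have h3 := h₁ (min δ₁ δ₂ / 2) ⟨(half_pos hm').le, (half_lt_self hm').trans_le (min_le_left _ _)⟩
    have h4 := h₂ (min δ₁ δ₂ / 2)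
      ⟨(half_pos hm').le, (half_lt_self hm').trans_le (min_le_right _ _)⟩
    rw [h3, add_right_inj, mul_left_inj' (half_pos hm').ne'] at h4
    exact_mod_cast h4
  rw [ordAt, ← finsum_comp ζ hζ, finsum_eq_sum_of_fintype]
  exact Finset.sum_congr rfl fun j _ => hts j

/-- The branches of a topological star of `C` at `x` are exactly the directions at `x`
along which one stays in `C`. -/
theorem exists_injective [Finite J] (h : MStar x σ r) {I : Type*} [Finite I] {C : Set G}
    {c : I → ℝ → G} {ε : ℝ} (hc : TStar C x c ε) : ∃ ι : I → J, Injective ι ∧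
      (∀ i, ∀ᶠ t in 𝓝[>] (0 : ℝ), σ (ι i) t ∈ C) ∧
      ∀ j ∉ range ι, ∀ᶠ t in 𝓝[>] (0 : ℝ), σ j t ∉ C := by
  have hη : ∃ η, 0 < η ∧ η ≤ ε ∧ ∀ i, ∀ t ∈ Ioo 0 η, dist x (c i t) < r := by
    have : ∀ i, ∀ᶠ t in 𝓝[>] (0 : ℝ), dist x (c i t) < r := fun i => by
      have h1 : Continuous fun t => dist x (c i t) := continuous_const.dist (hc.cont i)
      refine Filter.Eventually.filter_mono nhdsWithin_le_nhds
        ((h1.tendsto 0).eventually_lt_const ?_)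
      rw [hc.zero, dist_self]
      exact h.pos
    obtain ⟨δ, hδ, h1⟩ := eventually_Ioo_of_gt.1 (Filter.eventually_all.2 this)
    exact ⟨min δ ε, lt_min hδ hc.pos, min_le_right _ _,
      fun i t ht => h1 t ⟨ht.1, ht.2.trans_le (min_le_left _ _)⟩ i⟩
  obtain ⟨η, hη0, hηε, hη⟩ := hη
  have hmem : ∀ t ∈ Ioo 0 η, t ∈ Ioo 0 ε := fun t ht => ⟨ht.1, ht.2.trans_le hηε⟩
  have hpre : ∀ i, IsPreconnected (c i '' Ioo 0 η) :=
    fun i => isPreconnected_Ioo.image _ (hc.cont i).continuousOn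
  have hbr : ∀ i, ∃ j, c i '' Ioo 0 η ⊆ σ j '' Ioo 0 r := fun i =>
    h.subset_branch (hpre i)
      (by rintro _ ⟨t, ht, rfl⟩; exact hη i t ht)
      (by rintro ⟨t, ht, htx⟩; exact hc.ne i t (hmem t ht) htx)
      ((nonempty_Ioo.2 hη0).image _)
  choose ι hι using hbr
  have hrad : ∀ i, ∃ ρ > 0, ∀ t ∈ Ioo 0 ρ, σ (ι i) t ∈ c i '' Ioo 0 η := by
    intro i
    have ht0 : η / 2 ∈ Ioo 0 η := ⟨half_pos hη0, half_lt_self hη0⟩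
    have hx : c i (η / 2) ≠ x := hc.ne i _ (hmem _ ht0)
    refine ⟨dist x (c i (η / 2)), dist_pos.2 hx.symm, fun t ht => ?_⟩
    have hcont : ContinuousOn (fun t => dist x (c i t)) (Icc 0 (η / 2)) :=
      (continuous_const.dist (hc.cont i)).continuousOn
    obtain ⟨u, hu, hut⟩ := intermediate_value_Icc (half_pos hη0).le hcont
      (show t ∈ _ by simpa [hc.zero] using ⟨ht.1.le, ht.2.le⟩)
    have hu0 : u ≠ 0 := by
      rintro rfl
      simp only [hc.zero, dist_self] at hut
      exact ht.1.ne hut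
    have hu' : u ∈ Ioo 0 η := ⟨lt_of_le_of_ne hu.1 hu0.symm, hu.2.trans_lt ht0.2⟩
    refine ⟨u, hu', ?_⟩
    obtain ⟨s, hs, hsu⟩ := hι i ⟨u, hu', rfl⟩
    have h1 := h.dist_eq (ι i) ⟨hs.1.le, hs.2⟩
    simp only at hut
    rw [hsu, hut] at h1
    rw [h1, hsu]
  choose ρ hρ0 hρ using hrad
  refine ⟨ι, fun i i' hii => ?_, fun i => ?_, fun j hj => ?_⟩
  · have hm : 0 < min (ρ i) (ρ i') := lt_min (hρ0 i) (hρ0 i')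
    obtain ⟨s, hs, h1⟩ := hρ i _ ⟨half_pos hm, (half_lt_self hm).trans_le (min_le_left _ _)⟩
    obtain ⟨t, ht, h2⟩ := hρ i' _ ⟨half_pos hm, (half_lt_self hm).trans_le (min_le_right _ _)⟩
    rw [← hii, ← h1] at h2
    exact hc.inj i i' s (hmem s hs) t (hmem t ht) h2.symm
  · refine eventually_Ioo_of_gt.2 ⟨ρ i, hρ0 i, fun t ht => ?_⟩
    obtain ⟨s, hs, h1⟩ := hρ i t ht
    rw [← h1]
    exact hc.mem i s (hmem s hs)
  · obtain ⟨N, hN, hNC⟩ := hc.nhds η hη0 hηε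
    obtain ⟨δ, hδ, hδN⟩ := Metric.mem_nhds_iff.1 hN
    refine eventually_Ioo_of_gt.2 ⟨min δ r, lt_min hδ h.pos, fun t ht htC => ?_⟩
    have htr : t ∈ Ioo 0 r := ⟨ht.1, ht.2.trans_le (min_le_right _ _)⟩
    have hd := h.dist_eq j ⟨htr.1.le, htr.2⟩
    rcases hNC (σ j t) (hδN (by
      rw [Metric.mem_ball', hd]
      exact ht.2.trans_le (min_le_left _ _))) htC with h1 | ⟨i, s, hs, h1⟩
    · rw [h1, dist_self] at hd
      exact ht.1.ne hd
    · obtain ⟨u, hu, h2⟩ := hι i ⟨s, hs, h1⟩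
      exact hj ⟨i, h.inj _ _ u hu t htr h2⟩

end MStar

open Topology in
theorem exists_tStar_starNbhd {x : G} {v : ℕ} {U : Set G} (hU : U ∈ 𝓝 x)
    (h : IsStarNbhdOf x v U) : ∃ (c : Fin v → ℝ → G) (ε : ℝ), TStar univ x c ε := by
  obtain ⟨ε, hε, φ, hx, hφ⟩ := h
  obtain ⟨q, hq, hqe, hφ⟩ : ∃ q : Fin v × Ico (0 : ℝ) ε → StarGlue v ε, IsQuotientMap q ∧
      (∀ p p', q p = q p' → p = p' ∨ ((p.2 : ℝ) = 0 ∧ (p'.2 : ℝ) = 0)) ∧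
      ∀ i, φ ⟨x, hx⟩ = q (i, ⟨0, le_rfl, hε⟩) :=
    ⟨Quotient.mk (starSetoid v ε), isQuotientMap_quot_mk, fun _ _ h => Quotient.exact h, hφ⟩
  let cl : ℝ → Ico (0 : ℝ) ε := fun t =>
    ⟨max 0 (min t (ε / 2)), le_max_left _ _,
      max_lt hε ((min_le_right _ _).trans_lt (half_lt_self hε))⟩
  have hcl : Continuous cl := Continuous.subtype_mk (by fun_prop) _
  have hclt : ∀ t ∈ Ioo 0 (ε / 2), (cl t : ℝ) = t := fun t ht => by
    simp only [cl]
    rw [min_eq_left ht.2.le, max_eq_right ht.1.le]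
  have hc0 : ∀ i, q (i, cl 0) = φ ⟨x, hx⟩ := fun i => by
    rw [hφ i]
    congr 2
    ext
    simp only [cl]
    rw [min_eq_left (half_pos hε).le, max_self]
  refine ⟨fun i t => φ.symm (q (i, cl t)), ε / 2, half_pos hε,
    fun i => continuous_subtype_val.comp (φ.symm.continuous.comp
      (hq.continuous.comp (continuous_const.prodMk hcl))), fun i => ?_, fun _ _ _ => mem_univ _,
    fun i t ht he => ?_, fun i j s hs t ht he => ?_, fun η hη _ => ?_⟩
  · rw [hc0, φ.symm_apply_apply]
  · have h1 : φ.symm (q (i, cl t)) = ⟨x, hx⟩ := Subtype.ext he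
    rw [φ.symm_apply_eq, hφ i] at h1
    rcases hqe _ _ h1 with h2 | h2
    · have := congrArg (fun p : Fin v × Ico (0 : ℝ) ε => (p.2 : ℝ)) h2
      simp only [hclt t ht] at this
      exact ht.1.ne' this
    · have := h2.1
      simp only [hclt t ht] at this
      exact ht.1.ne' this
  · rcases hqe _ _ (φ.symm.injective (Subtype.ext he)) with h2 | h2
    · exact congrArg Prod.fst h2
    · have := h2.1
      simp only [hclt s hs] at this
      exact absurd this hs.1.ne'
  · let η' := min η (ε / 2)
    have hη' : 0 < η' := lt_min hη (half_pos hε)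
    let O : Set (StarGlue v ε) := {z | ∀ p, q p = z → (p.2 : ℝ) < η'}
    have hO : IsOpen O := by
      refine (hq).isOpen_preimage.1 ?_
      have : q ⁻¹' O = {p | (p.2 : ℝ) < η'} := by
        ext p
        constructor
        · exact fun hp => hp p rfl
        · intro hp p' hp'
          rcases hqe _ _ hp' with rfl | h2
          · exact hp
          · rw [h2.1]; exact hη'
      rw [this]
      exact isOpen_lt (by fun_prop) continuous_const
    have hN : Subtype.val '' (φ ⁻¹' O) ∈ 𝓝 x := by
      have h1 : φ ⁻¹' O ∈ 𝓝 (⟨x, hx⟩ : U) := by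
        refine (hO.preimage φ.continuous).mem_nhds ?_
        intro p hp
        rw [hφ p.1] at hp
        rcases hqe _ _ hp with h2 | h2
        · rw [h2]; exact hη'
        · rw [h2.1]; exact hη'
      have h2 := Filter.image_mem_map (m := Subtype.val) h1
      rwa [map_nhds_subtype_coe_eq_nhds hx hU] at h2
    refine ⟨_, hN, ?_⟩
    rintro _ ⟨y, hy, rfl⟩ -
    obtain ⟨⟨i, t⟩, hp⟩ := hq.surjective (φ y)
    have hlt : (t : ℝ) < η' := hy _ hp
    rcases t.2.1.eq_or_lt with h0 | h0
    · left
      have : y = ⟨x, hx⟩ := by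
        apply φ.injective
        rw [← hp, hφ i]
        congr 2
        exact Subtype.ext h0.symm
      rw [this]
    · right
      refine ⟨i, t, ⟨h0, hlt.trans_le (min_le_left _ _)⟩, ?_⟩
      have : cl t = t := Subtype.ext (hclt t ⟨h0, hlt.trans_le (min_le_right _ _)⟩)
      simp only [this, hp, φ.symm_apply_apply]

open Topology in
theorem exists_tStar_cycle {C : Set G} (hC : IsCycleSet C) {x : G} (hx : x ∈ C) :
    ∃ c : Bool → ℝ → G, TStar C x c (1 / 2) := by
  obtain ⟨ψ⟩ := hC
  let sg : Bool → ℝ → ℝ := fun b t => if b then t else -t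
  have hsg : ∀ b, Continuous (sg b) := fun b => by
    cases b
    · simpa [sg] using continuous_neg
    · simpa [sg] using continuous_id'
  have hcoe : Continuous ((↑) : ℝ → AddCircle (1 : ℝ)) := AddCircle.continuous_mk' 1
  have hinj : ∀ a b : ℝ, |a - b| < 1 → (a : AddCircle (1 : ℝ)) = b → a = b := by
    intro a b hab he
    obtain ⟨n, hn⟩ := (AddCircle.coe_eq_zero_iff 1 (x := a - b)).1
      (by rw [AddCircle.coe_sub, he, sub_self])
    rw [zsmul_one] at hn
    rw [← hn] at hab
    have : n = 0 := Int.abs_lt_one_iff.1 (by exact_mod_cast hab)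
    rw [this, Int.cast_zero] at hn
    linarith
  refine ⟨fun b t => ψ.symm (ψ ⟨x, hx⟩ + (sg b t : ℝ)), by norm_num, fun i => ?_, fun i => ?_,
    fun i t _ => Subtype.coe_prop _, fun i t ht he => ?_, fun i j s hs t ht he => ?_,
    fun η hη _ => ?_⟩
  · exact continuous_subtype_val.comp (ψ.symm.continuous.comp
      (continuous_const.add (hcoe.comp (hsg i))))
  · cases i <;> simp [sg]
  · have h1 : ψ.symm (ψ ⟨x, hx⟩ + (sg i t : ℝ)) = ⟨x, hx⟩ := Subtype.ext he
    rw [ψ.symm_apply_eq, add_eq_left] at h1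
    have h2 := hinj (sg i t) 0 (by
      cases i <;> simp [sg, abs_of_pos ht.1] <;> linarith [ht.2]) (by simpa using h1)
    have := ht.1
    cases i <;> simp [sg] at h2 <;> linarith
  · have h1 := add_left_cancel (ψ.symm.injective (Subtype.ext he))
    have h2 := hinj _ _ (by
      have := hs.1; have := hs.2; have := ht.1; have := ht.2
      rw [abs_lt]
      cases i <;> cases j <;> simp [sg] <;> constructor <;> linarith) h1
    have := hs.1
    have := ht.1
    cases i <;> cases j <;> simp [sg] at h2 ⊢ <;> linarith
  · let O : Set (AddCircle (1 : ℝ)) := (↑) '' Ioo (-η) η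
    have hO : IsOpen O := QuotientAddGroup.isOpenMap_coe _ isOpen_Ioo
    have hmem : {y : C | ψ y - ψ ⟨x, hx⟩ ∈ O} ∈ 𝓝 (⟨x, hx⟩ : C) := by
      refine (hO.preimage (ψ.continuous.sub continuous_const)).mem_nhds ?_
      exact ⟨0, ⟨neg_lt_zero.2 hη, hη⟩, by simp⟩
    obtain ⟨N, hN, hNC⟩ := mem_nhds_subtype _ _ _ |>.1 hmem
    refine ⟨N, hN, fun y hyN hyC => ?_⟩
    obtain ⟨u, hu, hu'⟩ := hNC (show (⟨y, hyC⟩ : C) ∈ Subtype.val ⁻¹' N from hyN)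
    have hy : ∀ b t, sg b t = u → (ψ.symm (ψ ⟨x, hx⟩ + (sg b t : ℝ)) : G) = y := by
      rintro b t rfl
      rw [hu', add_sub_cancel, ψ.symm_apply_apply]
    rcases lt_trichotomy u 0 with h0 | h0 | h0
    · exact Or.inr ⟨false, -u, ⟨neg_pos.2 h0, neg_lt.1 hu.1⟩, hy _ _ (by simp [sg])⟩
    · left
      have := hy true 0 (by simp [sg, h0])
      simpa [sg] using this.symm
    · exact Or.inr ⟨true, u, ⟨h0, hu.2⟩, hy _ _ (by simp [sg])⟩

theorem MStar.card_eq_of_hasValence {J : Type*} [Fintype J] {x : G} {σ : J → ℝ → G} {r : ℝ}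
    (h : MStar x σ r) {v : ℕ} (hv : HasValence x v) : Fintype.card J = v := by
  obtain ⟨U, hU, hs⟩ := hv
  obtain ⟨c, ε, hc⟩ := exists_tStar_starNbhd hU hs
  obtain ⟨ι, hι, -, h2⟩ := h.exists_injective hc
  have hsurj : Surjective ι := fun j => by
    by_contra hj
    obtain ⟨t, ht⟩ := (h2 j hj).exists
    exact ht (mem_univ _)
  simpa using (Fintype.card_of_bijective ⟨hι, hsurj⟩).symm

/-! ### Edge parametrizations -/

/-- A presentation of `G` by finitely many vertices and edges.  The dart `(e, b)` is the edge `e`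
with one of its two orientations, and `br (e, b)` is its unit speed parametrization. -/
structure EdgeModel (G : Type*) [MetricSpace G] (E : Type*) where
  W : Finset G
  len : E → ℝ
  br : E × Bool → ℝ → G
  len_pos : ∀ e, 0 < len e
  rev : ∀ δ t, br (δ.1, !δ.2) t = br δ (len δ.1 - t)
  isom : ∀ δ, ∀ s ∈ Icc 0 (len δ.1), ∀ t ∈ Icc 0 (len δ.1), dist (br δ s) (br δ t) = |s - t|
  src_mem : ∀ δ, br δ 0 ∈ W
  not_mem : ∀ δ, ∀ t ∈ Ioo 0 (len δ.1), br δ t ∉ W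
  disj : ∀ δ δ', ∀ s ∈ Ioo 0 (len δ.1), ∀ t ∈ Ioo 0 (len δ'.1), br δ s = br δ' t → δ.1 = δ'.1
  cover : ∀ x, x ∈ W ∨ ∃ e, ∃ t ∈ Ioo 0 (len e), br (e, false) t = x

namespace EdgeModel

open Topology

variable {E : Type*} (M : EdgeModel G E)

theorem continuousOn (δ : E × Bool) : ContinuousOn (M.br δ) (Icc 0 (M.len δ.1)) := by
  refine Metric.continuousOn_iff.2 fun b hb ε hε => ⟨ε, hε, fun a ha hab => ?_⟩
  rwa [M.isom δ a ha b hb]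

theorem injOn (δ : E × Bool) : InjOn (M.br δ) (Icc 0 (M.len δ.1)) := by
  intro s hs t ht hst
  have := M.isom δ s hs t ht
  rw [hst, dist_self] at this
  exact sub_eq_zero.1 (abs_eq_zero.1 this.symm)

theorem br_len (δ : E × Bool) : M.br δ (M.len δ.1) = M.br (δ.1, !δ.2) 0 := by
  rw [M.rev, sub_zero]

theorem eq_or_rev (δ δ' : E × Bool) (h : δ.1 = δ'.1) : δ' = δ ∨ δ' = (δ.1, !δ.2) := by
  obtain ⟨e, b⟩ := δ
  obtain ⟨e', b'⟩ := δ'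
  obtain rfl : e = e' := h
  cases b <;> cases b' <;> simp

theorem src_ne (δ : E × Bool) : M.br δ 0 ≠ M.br (δ.1, !δ.2) 0 := by
  rw [← M.br_len]
  intro h
  have := M.injOn δ ⟨le_rfl, (M.len_pos _).le⟩ ⟨(M.len_pos _).le, le_rfl⟩ h
  exact (M.len_pos _).ne this

/-- The closed edge `e`. -/
def closedEdge (e : E) : Set G := M.br (e, false) '' Icc 0 (M.len e)

theorem exists_br_of_mem (δ : E × Bool) {y : G}
    (hy : ∃ t ∈ Ioo 0 (M.len δ.1), M.br (δ.1, false) t = y) :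
    ∃ t ∈ Ioo 0 (M.len δ.1), M.br δ t = y := by
  obtain ⟨e, b⟩ := δ
  cases b
  · exact hy
  · obtain ⟨t, ht, rfl⟩ := hy
    refine ⟨M.len e - t, ⟨sub_pos.2 ht.2, sub_lt_self _ ht.1⟩, ?_⟩
    rw [← M.rev (e, true) t]
    rfl

theorem eventually_far [Finite E] (x : G) : ∀ᶠ r in 𝓝[>] (0 : ℝ), (∀ e, r < M.len e) ∧
    (∀ w ∈ M.W, w ≠ x → r ≤ dist x w) ∧
    ∀ e, x ∉ M.closedEdge e → ∀ y ∈ M.closedEdge e, r ≤ dist x y := by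
  have hlt : ∀ c : ℝ, 0 < c → ∀ᶠ r in 𝓝[>] (0 : ℝ), r < c := fun c hc =>
    Filter.Eventually.filter_mono nhdsWithin_le_nhds (eventually_lt_nhds hc)
  refine (Filter.eventually_all.2 fun e => hlt _ (M.len_pos e)).and (Filter.Eventually.and ?_ ?_)
  · refine (Filter.eventually_all_finset _).2 fun w _ => ?_
    by_cases hw : w = x
    · simp [hw]
    · filter_upwards [hlt _ (dist_pos.2 (Ne.symm hw))] with r hr _ using hr.le
  · refine Filter.eventually_all.2 fun e => ?_
    by_cases hx : x ∈ M.closedEdge e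
    · simp [hx]
    · have hc : IsClosed (M.closedEdge e) :=
        (isCompact_Icc.image_of_continuousOn (M.continuousOn (e, false))).isClosed
      obtain ⟨c, hc, hd⟩ := Metric.isOpen_iff.1 hc.isOpen_compl x hx
      filter_upwards [hlt _ hc] with r hr _ y hy
      by_contra! hlt
      exact hd (Metric.mem_ball'.2 (hlt.trans hr)) hy

theorem exists_mStar_vertex [Finite E] {w : G} (hw : w ∈ M.W) :
    ∃ r, MStar w (fun δ : {δ // M.br δ 0 = w} => M.br δ.1) r := by
  obtain ⟨r, ⟨h1, h2, h3⟩, hr⟩ := ((M.eventually_far w).and self_mem_nhdsWithin).exists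
  refine ⟨r, hr, fun δ => ⟨δ.2, fun s hs t ht => M.isom _ s ⟨hs.1, (hs.2.trans (h1 _)).le⟩ t
    ⟨ht.1, (ht.2.trans (h1 _)).le⟩⟩, fun δ δ' s hs t ht h => ?_, fun y hy => ?_⟩
  · have h4 := M.disj δ.1 δ'.1 s ⟨hs.1, hs.2.trans (h1 _)⟩ t ⟨ht.1, ht.2.trans (h1 _)⟩ h
    rcases eq_or_rev _ _ h4 with h5 | h5
    · exact (Subtype.ext h5).symm
    · have := M.src_ne δ.1
      rw [← h5, δ.2, δ'.2] at this
      exact absurd rfl this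
  · rcases M.cover y with hyW | ⟨e, t, ht, rfl⟩
    · left
      by_contra hne
      exact (h2 y hyW hne).not_gt hy
    · right
      have hmem : w ∈ M.closedEdge e := by
        by_contra hmem
        exact (h3 e hmem _ ⟨t, Ioo_subset_Icc_self ht, rfl⟩).not_gt hy
      have key : ∀ b, M.br (e, b) 0 = w → ∃ j : {δ // M.br δ 0 = w},
          M.br j.1 (dist w (M.br (e, false) t)) = M.br (e, false) t := by
        intro b hb
        obtain ⟨s, hs, hst⟩ := M.exists_br_of_mem (e, b) ⟨t, ht, rfl⟩
        refine ⟨⟨(e, b), hb⟩, ?_⟩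
        change M.br (e, b) (dist w (M.br (e, false) t)) = _
        rw [← hst, ← hb, M.isom (e, b) 0 ⟨le_rfl, (M.len_pos _).le⟩ s (Ioo_subset_Icc_self hs),
          zero_sub, abs_neg, abs_of_pos hs.1]
      obtain ⟨s, hs, hsw⟩ := hmem
      rcases hs.1.eq_or_lt with rfl | hs0
      · exact key false hsw
      · rcases hs.2.eq_or_lt with rfl | hs1
        · exact key true (by rw [← hsw]; exact (M.br_len (e, false)).symm)
        · exact absurd (hsw ▸ hw) (M.not_mem (e, false) s ⟨hs0, hs1⟩)

theorem exists_mStar_interior [Finite E] (δ : E × Bool) {t : ℝ} (ht : t ∈ Ioo 0 (M.len δ.1)) :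
    ∃ r, MStar (M.br δ t) (fun (b : Bool) s => M.br δ (if b then t + s else t - s)) r := by
  have hlt : ∀ c : ℝ, 0 < c → ∀ᶠ r in 𝓝[>] (0 : ℝ), r < c := fun c hc =>
    Filter.Eventually.filter_mono nhdsWithin_le_nhds (eventually_lt_nhds hc)
  obtain ⟨r, ⟨⟨⟨h1, h2, h3⟩, h4⟩, h5⟩, hr⟩ := ((((M.eventually_far (M.br δ t)).and
    (hlt t ht.1)).and (hlt _ (sub_pos.2 ht.2))).and self_mem_nhdsWithin).exists
  have hr : 0 < r := hr
  have hmem : ∀ (b : Bool), ∀ s ∈ Ico 0 r, (if b then t + s else t - s) ∈ Icc 0 (M.len δ.1) := by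
    intro b s hs
    have := hs.1
    have := hs.2
    have := ht.1
    have := ht.2
    cases b <;> simp <;> constructor <;> linarith
  refine ⟨r, hr, fun b => ⟨by simp, fun s hs u hu => ?_⟩, fun b b' s hs u hu h => ?_,
    fun y hy => ?_⟩
  · simp only
    rw [M.isom δ _ (hmem b s hs) _ (hmem b u hu)]
    cases b
    · simp only [Bool.false_eq_true, if_false, sub_sub_sub_cancel_left]
      exact abs_sub_comm _ _
    · simp
  · have h6 := M.injOn δ (hmem b s ⟨hs.1.le, hs.2⟩) (hmem b' u ⟨hu.1.le, hu.2⟩) h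
    have := hs.1
    have := hu.1
    cases b <;> cases b' <;> simp at h6 ⊢ <;> linarith
  · rcases M.cover y with hyW | ⟨e, u, hu, rfl⟩
    · refine absurd hy (h2 y hyW ?_).not_gt
      rintro rfl
      exact M.not_mem _ _ ht hyW
    · right
      have he : δ.1 = e := by
        by_contra he
        refine absurd hy (h3 e ?_ _ ⟨u, Ioo_subset_Icc_self hu, rfl⟩).not_gt
        rintro ⟨s, hs, hst⟩
        rcases hs.1.eq_or_lt with rfl | hs0
        · exact M.not_mem _ _ ht (hst ▸ M.src_mem _)
        · rcases hs.2.eq_or_lt with rfl | hs1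
          · refine M.not_mem _ _ ht (hst ▸ ?_)
            have := M.br_len (e, false)
            rw [this]
            exact M.src_mem _
          · exact he (M.disj (e, false) δ s ⟨hs0, hs1⟩ t ht hst).symm
      subst he
      obtain ⟨s, hs, hsu⟩ := M.exists_br_of_mem δ ⟨u, hu, rfl⟩
      rw [← hsu, M.isom δ t (Ioo_subset_Icc_self ht) s (Ioo_subset_Icc_self hs)]
      rcases le_total t s with hts | hts
      · exact ⟨true, by rw [abs_of_nonpos (sub_nonpos.2 hts)]; simp⟩
      · exact ⟨false, by rw [abs_of_nonneg (sub_nonneg.2 hts)]; simp⟩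

theorem eventually_vertex [Finite E] {P : G → Prop} {w : G} (hw : w ∈ M.W) (hP : P w)
    (h : ∀ δ, M.br δ 0 = w → ∀ᶠ t in 𝓝[>] (0 : ℝ), P (M.br δ t)) : ∀ᶠ y in 𝓝 w, P y := by
  obtain ⟨r, hr⟩ := M.exists_mStar_vertex hw
  exact hr.eventually hP fun δ => h δ.1 δ.2

theorem eventually_interior [Finite E] {P : G → Prop} (δ : E × Bool) {t : ℝ}
    (ht : t ∈ Ioo 0 (M.len δ.1)) (h : ∀ᶠ s in 𝓝 t, P (M.br δ s)) :
    ∀ᶠ y in 𝓝 (M.br δ t), P y := by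
  obtain ⟨r, hr⟩ := M.exists_mStar_interior δ ht
  refine hr.eventually h.self_of_nhds fun b => ?_
  have hc : Filter.Tendsto (fun s : ℝ => if b then t + s else t - s) (𝓝[>] 0) (𝓝 t) := by
    refine Filter.Tendsto.mono_left ?_ nhdsWithin_le_nhds
    have : Continuous fun s : ℝ => if b then t + s else t - s := by
      cases b <;> simp <;> fun_prop
    simpa using this.tendsto 0
  exact hc.eventually h

/-- Functions on `G` can be defined separately on the vertices and on the open edges. -/
theorem exists_glue {β : Type*} (h : G → β) (φ : E → ℝ → β) : ∃ f : G → β,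
    (∀ w ∈ M.W, f w = h w) ∧ ∀ e, ∀ t ∈ Ioo 0 (M.len e), f (M.br (e, false) t) = φ e t := by
  classical
  have hcov : ∀ x, x ∉ M.W → ∃ q : E × ℝ, q.2 ∈ Ioo 0 (M.len q.1) ∧ M.br (q.1, false) q.2 = x :=
    fun x hx => by
      obtain ⟨e, t, ht, he⟩ := (M.cover x).resolve_left hx
      exact ⟨(e, t), ht, he⟩
  choose q hq hqx using hcov
  refine ⟨fun x => if hx : x ∈ M.W then h x else φ (q x hx).1 (q x hx).2, fun w hw => dif_pos hw,
    fun e t ht => ?_⟩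
  have hW := M.not_mem (e, false) t ht
  have h1 : (q _ hW).1 = e :=
    M.disj (_, false) (e, false) _ (hq _ hW) t ht (hqx _ hW)
  have h2 := hq _ hW
  have h3 := hqx _ hW
  rw [h1] at h2 h3
  refine (dif_neg hW).trans ?_
  rw [h1, M.injOn (e, false) (Ioo_subset_Icc_self h2) (Ioo_subset_Icc_self ht) h3]

theorem reach [Finite E] [ConnectedSpace G] {z w : G} (hz : z ∈ M.W) (hw : w ∈ M.W) :
    Relation.ReflTransGen (fun a b => ∃ δ, M.br δ 0 = a ∧ M.br (δ.1, !δ.2) 0 = b) z w := by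
  set R := fun a b => ∃ δ, M.br δ 0 = a ∧ M.br (δ.1, !δ.2) 0 = b with hR
  have hadj : ∀ δ, Relation.ReflTransGen R z (M.br δ 0) →
      Relation.ReflTransGen R z (M.br (δ.1, !δ.2) 0) := fun δ h => h.tail ⟨δ, rfl, rfl⟩
  obtain ⟨L, hLW, hLe⟩ := M.exists_glue (fun w => Relation.ReflTransGen R z w)
    (fun e _ => Relation.ReflTransGen R z (M.br (e, false) 0))
  have hLe' : ∀ δ : E × Bool, ∀ t ∈ Ioo 0 (M.len δ.1), L (M.br δ t) = L (M.br δ 0) := by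
    rintro ⟨e, b⟩ t ht
    rw [hLW _ (M.src_mem _)]
    cases b
    · exact hLe e t ht
    · have h1 : M.br (e, true) t = M.br (e, false) (M.len e - t) := M.rev (e, false) t
      rw [h1, hLe e _ ⟨sub_pos.2 ht.2, sub_lt_self _ ht.1⟩]
      exact propext ⟨hadj (e, false), hadj (e, true)⟩
  have hloc : IsLocallyConstant L := by
    refine (IsLocallyConstant.iff_eventually_eq L).2 fun x => ?_
    rcases M.cover x with hx | ⟨e, t, ht, rfl⟩
    · refine M.eventually_vertex hx rfl ?_
      rintro δ rfl
      filter_upwards [Ioo_mem_nhdsGT (M.len_pos δ.1)] with t ht using hLe' δ t ht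
    · refine M.eventually_interior (e, false) ht ?_
      filter_upwards [Ioo_mem_nhds ht.1 ht.2] with s hs
      rw [hLe' _ s hs, hLe' _ t ht]
  have := hloc.apply_eq_of_preconnectedSpace z w
  rw [hLW z hz, hLW w hw] at this
  exact this ▸ Relation.ReflTransGen.refl

end EdgeModel

/-! ### Existence of edge parametrizations -/

open Topology in
/-- An isometric parametrization of an open interval extends to the closed interval. -/
theorem exists_isometric_extension [CompactSpace G] {a b : ℝ} (hab : a < b) {γ : ℝ → G}
    (hγ : ∀ s ∈ Ioo a b, ∀ t ∈ Ioo a b, dist (γ s) (γ t) = |s - t|) :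
    ∃ q : ℝ → G, EqOn q γ (Ioo a b) ∧
      ∀ s ∈ Icc a b, ∀ t ∈ Icc a b, dist (q s) (q t) = |s - t| := by
  have hcont : ContinuousOn γ (Ioo a b) := by
    refine Metric.continuousOn_iff.2 fun c hc ε hε => ⟨ε, hε, fun d hd hdc => ?_⟩
    rwa [hγ d hd c hc]
  have hlim : ∀ c, (𝓝[Ioo a b] c).NeBot → ∃ l, Filter.Tendsto γ (𝓝[Ioo a b] c) (𝓝 l) := by
    intro c hc
    refine CompleteSpace.complete (Metric.cauchy_iff.2 ⟨hc.map _, fun ε hε => ?_⟩)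
    refine ⟨γ '' (Metric.ball c (ε / 2) ∩ Ioo a b), Filter.image_mem_map
      (Filter.inter_mem (mem_nhdsWithin_of_mem_nhds (Metric.ball_mem_nhds c (half_pos hε)))
        self_mem_nhdsWithin), ?_⟩
    rintro _ ⟨s, hs, rfl⟩ _ ⟨t, ht, rfl⟩
    rw [hγ s hs.2 t ht.2, ← Real.dist_eq]
    have h1 := dist_triangle_right s t c
    have h2 := Metric.mem_ball.1 hs.1
    have h3 := Metric.mem_ball.1 ht.1
    linarith
  obtain ⟨la, hla⟩ := hlim a (by
    rw [nhdsWithin_Ioo_eq_nhdsGT hab]; infer_instance)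
  obtain ⟨lb, hlb⟩ := hlim b (by
    rw [nhdsWithin_Ioo_eq_nhdsLT hab]; infer_instance)
  rw [nhdsWithin_Ioo_eq_nhdsGT hab] at hla
  rw [nhdsWithin_Ioo_eq_nhdsLT hab] at hlb
  have hq := continuousOn_Icc_extendFrom_Ioo hcont hla hlb
  have heq : EqOn (extendFrom (Ioo a b) γ) γ (Ioo a b) := fun t ht =>
    extendFrom_eq (subset_closure ht) (hcont t ht)
  refine ⟨extendFrom (Ioo a b) γ, heq, ?_⟩
  have key : EqOn (fun p : ℝ × ℝ => dist (extendFrom (Ioo a b) γ p.1) (extendFrom (Ioo a b) γ p.2))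
      (fun p => |p.1 - p.2|) (Icc a b ×ˢ Icc a b) := by
    refine EqOn.of_subset_closure (s := Ioo a b ×ˢ Ioo a b) ?_ ?_ (by fun_prop)
      (prod_mono Ioo_subset_Icc_self Ioo_subset_Icc_self) ?_
    · rintro ⟨s, t⟩ ⟨hs, ht⟩
      simp only [heq hs, heq ht, hγ s hs t ht]
    · have h1 : ContinuousOn (fun p : ℝ × ℝ => extendFrom (Ioo a b) γ p.1) (Icc a b ×ˢ Icc a b) :=
        hq.comp continuousOn_fst fun p hp => hp.1
      have h2 : ContinuousOn (fun p : ℝ × ℝ => extendFrom (Ioo a b) γ p.2) (Icc a b ×ˢ Icc a b) :=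
        hq.comp continuousOn_snd fun p hp => hp.2
      exact continuous_dist.comp_continuousOn (h1.prodMk h2)
    · rw [closure_prod_eq, closure_Ioo hab.ne]
  exact fun s hs t ht => key (mk_mem_prod hs ht)

theorem closure_inter_subset_of_mem_compsOf {A C : Set G} (hC : C ∈ compsOf A) :
    closure C ∩ A ⊆ C := by
  obtain ⟨x, hx, rfl⟩ := hC
  have hsub := connectedComponentIn_subset A x
  have hmem := mem_connectedComponentIn hx
  exact IsPreconnected.subset_connectedComponentIn
    (isPreconnected_connectedComponentIn.subset_closure
      (subset_inter subset_closure hsub) inter_subset_left)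
    ⟨subset_closure hmem, hx⟩ inter_subset_right

theorem eq_of_mem_compsOf {A C D : Set G} (hC : C ∈ compsOf A) (hD : D ∈ compsOf A) {y : G}
    (hyC : y ∈ C) (hyD : y ∈ D) : C = D := by
  obtain ⟨c, hc, rfl⟩ := hC
  obtain ⟨d, hd, rfl⟩ := hD
  rw [connectedComponentIn_eq hyC, connectedComponentIn_eq hyD]

theorem exists_edgeModel.{u} {G : Type u} [MetricSpace G] [CompactSpace G] {V : Set G}
    (hV : V.Finite) (hfin : (compsOf (univ \ V)).Finite)
    (harc : ∀ C ∈ compsOf (univ \ V), IsOpenArc C) :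
    ∃ (E : Type u) (_ : Fintype E) (M : EdgeModel G E), (M.W : Set G) = V ∧
      Fintype.card E = (compsOf (univ \ V)).ncard := by
  classical
  have hA : IsOpen (univ \ V) := isOpen_univ.sdiff hV.isClosed
  have hpar : ∀ C : compsOf (univ \ V), ∃ (l : ℝ) (q : ℝ → G), 0 < l ∧ (C : Set G) = q '' Ioo 0 l ∧
      (∀ s ∈ Icc 0 l, ∀ t ∈ Icc 0 l, dist (q s) (q t) = |s - t|) ∧ q 0 ∈ V ∧ q l ∈ V := by
    rintro ⟨C, hC⟩
    obtain ⟨a, b, γ, hab, hγ, hCγ⟩ := harc C hC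
    obtain ⟨q, hqγ, hq⟩ := exists_isometric_extension hab hγ
    have hCq : C = q '' Ioo a b := by rw [hCγ, image_congr hqγ]
    have hcont : ContinuousOn q (Icc a b) := by
      refine Metric.continuousOn_iff.2 fun c hc ε hε => ⟨ε, hε, fun d hd hdc => ?_⟩
      rwa [hq d hd c hc]
    have hend : ∀ c ∈ Icc a b, c ∉ Ioo a b → q c ∈ V := by
      intro c hc hc'
      by_contra hcV
      have hcl : q c ∈ closure C := by
        have h1 : c ∈ closure (Ioo a b) := by rwa [closure_Ioo hab.ne]
        rw [hCq]
        exact (hcont c hc).mono Ioo_subset_Icc_self |>.mem_closure_image h1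
      have := closure_inter_subset_of_mem_compsOf hC ⟨hcl, mem_univ _, hcV⟩
      rw [hCq] at this
      obtain ⟨t, ht, htc⟩ := this
      have h1 := hq t (Ioo_subset_Icc_self ht) c hc
      rw [htc, dist_self] at h1
      exact hc' (sub_eq_zero.1 (abs_eq_zero.1 h1.symm) ▸ ht)
    refine ⟨b - a, fun t => q (a + t), sub_pos.2 hab, ?_, ?_, ?_, ?_⟩
    · change C = _
      rw [hCq, ← image_image q (fun t => a + t), image_const_add_Ioo]
      simp
    · intro s hs t ht
      rw [hq _ ⟨by linarith [hs.1], by linarith [hs.2]⟩ _ ⟨by linarith [ht.1], by linarith [ht.2]⟩,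
        add_sub_add_left_eq_sub]
    · exact hend _ (by simp [hab.le]) (by simp)
    · exact hend _ (by simp [hab.le]) (by simp)
  choose l q hl hCq hq hq0 hql using hpar
  have : Fintype (compsOf (univ \ V)) := hfin.fintype
  have hmaps : ∀ (C : compsOf (univ \ V)), ∀ b : Bool, ∀ t ∈ Ioo 0 (l C),
      (if b then q C (l C - t) else q C t) ∈ (C : Set G) := by
    intro C b t ht
    rw [hCq C]
    cases b
    · exact ⟨t, ht, rfl⟩
    · exact ⟨l C - t, ⟨sub_pos.2 ht.2, sub_lt_self _ ht.1⟩, rfl⟩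
  refine ⟨compsOf (univ \ V), this,
    { W := hV.toFinset
      len := l
      br := fun δ t => if δ.2 then q δ.1 (l δ.1 - t) else q δ.1 t
      len_pos := hl
      rev := ?_
      isom := ?_
      src_mem := ?_
      not_mem := ?_
      disj := ?_
      cover := ?_ }, by simp, ?_⟩
  · rintro ⟨C, b⟩ t
    cases b <;> simp
  · rintro ⟨C, b⟩ s hs t ht
    cases b
    · exact hq C s hs t ht
    · simp only [if_true]
      rw [hq C _ ⟨sub_nonneg.2 hs.2, sub_le_self _ hs.1⟩ _ ⟨sub_nonneg.2 ht.2, sub_le_self _ ht.1⟩,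
        sub_sub_sub_cancel_left, abs_sub_comm]
  · rintro ⟨C, b⟩
    cases b <;> simp [hq0, hql]
  · rintro ⟨C, b⟩ t ht h
    have h1 := hmaps C b t ht
    obtain ⟨x, hx, hCx⟩ := C.2
    rw [hCx] at h1
    exact (connectedComponentIn_subset _ _ h1).2 (hV.mem_toFinset.1 h)
  · rintro ⟨C, b⟩ ⟨C', b'⟩ s hs t ht h
    exact Subtype.ext (eq_of_mem_compsOf C.2 C'.2 (hmaps C b s hs) (by
      have := hmaps C' b' t ht
      simp only at h
      rwa [← h] at this))
  · intro x
    by_cases hx : x ∈ V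
    · exact Or.inl (hV.mem_toFinset.2 hx)
    · right
      have hx' : x ∈ univ \ V := ⟨mem_univ _, hx⟩
      have h1 := mem_connectedComponentIn hx'
      obtain ⟨t, ht, h2⟩ := (hCq ⟨_, ⟨x, hx', rfl⟩⟩).subset h1
      exact ⟨⟨_, ⟨x, hx', rfl⟩⟩, t, ht, h2⟩
  · rw [← Nat.card_coe_set_eq, Nat.card_eq_fintype_card]

theorem EdgeModel.card_darts {E : Type*} [Fintype E] (M : EdgeModel G E) {v : G → ℕ}
    (hv : ∀ w ∈ M.W, HasValence w (v w)) : ∑ w ∈ M.W, v w = 2 * Fintype.card E := by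
  classical
  have h : ∀ w ∈ M.W, v w = (Finset.univ.filter fun δ => M.br δ 0 = w).card := by
    intro w hw
    obtain ⟨r, hr⟩ := M.exists_mStar_vertex hw
    rw [← hr.card_eq_of_hasValence (hv w hw), Fintype.card_subtype]
  rw [Finset.sum_congr rfl h, ← Finset.card_eq_sum_card_fiberwise fun δ _ => M.src_mem δ]
  simp [mul_comm]

/-- The genus is computed by any edge parametrization coming from a model. -/
theorem exists_edgeModel_of_genus.{u} {G : Type u} [MetricSpace G] [CompactSpace G]
    [ConnectedSpace G] {g : ℤ} (hg : HasGenusOpen (univ : Set G) g) :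
    ∃ (E : Type u) (_ : Fintype E) (M : EdgeModel G E), g = Fintype.card E - M.W.card + 1 := by
  obtain ⟨V, v, ⟨-, hV, hval, hfin, harc, -⟩, hg⟩ := hg
  obtain ⟨E, hE, M, hMV, hcard⟩ := exists_edgeModel hV hfin harc
  refine ⟨E, hE, M, ?_⟩
  have h1 := M.card_darts (v := v) fun w hw => by
    obtain ⟨U, hU, -, hs⟩ := hval w (hMV ▸ hw)
    exact ⟨U, hU, hs⟩
  have h2 : compsOf (univ : Set G) = {univ} := by
    ext C
    simp only [compsOf, connectedComponentIn_univ, mem_ofPred_eq, mem_univ, true_and,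
      PreconnectedSpace.connectedComponent_eq_univ, mem_singleton_iff]
    exact ⟨fun ⟨_, h⟩ => h, fun h => ⟨Classical.arbitrary G, h⟩⟩
  rw [hg, h2, ncard_singleton, ← hcard, ← hMV, ncard_coe_finset]
  have h3 : (∑ᶠ x ∈ (M.W : Set G), (v x : ℤ)) = 2 * Fintype.card E := by
    rw [finsum_mem_coe_finset]
    exact_mod_cast h1
  rw [h3]
  push_cast
  ring

/-! ### Cycles in terms of edges -/

namespace EdgeModel

open Topology

variable {E : Type*} (M : EdgeModel G E)

theorem eventually_mem_cycle [Finite E] {C : Set G} (hC : IsCycleSet C) (δ : E × Bool) {t : ℝ}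
    (ht : t ∈ Ioo 0 (M.len δ.1)) (htC : M.br δ t ∈ C) : ∀ᶠ s in 𝓝 t, M.br δ s ∈ C := by
  obtain ⟨r, hr⟩ := M.exists_mStar_interior δ ht
  obtain ⟨c, hc⟩ := exists_tStar_cycle hC htC
  obtain ⟨ι, hι, h1, -⟩ := hr.exists_injective hc
  have hall : ∀ b : Bool, ∀ᶠ s in 𝓝[>] (0 : ℝ), M.br δ (if b then t + s else t - s) ∈ C := by
    intro b
    obtain ⟨a, rfl⟩ := (Finite.injective_iff_surjective.1 hι) b
    exact h1 a
  obtain ⟨η, hη, hηC⟩ := eventually_Ioo_of_gt.1 (Filter.eventually_all.2 hall)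
  filter_upwards [Ioo_mem_nhds (sub_lt_self t hη) (lt_add_of_pos_right t hη)] with s hs
  rcases lt_trichotomy s t with h | rfl | h
  · simpa using hηC (t - s) ⟨sub_pos.2 h, by linarith [hs.1]⟩ false
  · exact htC
  · simpa using hηC (s - t) ⟨sub_pos.2 h, by linarith [hs.2]⟩ true

theorem isClosed_cycle {C : Set G} (hC : IsCycleSet C) : IsClosed C := by
  obtain ⟨ψ⟩ := hC
  have : CompactSpace C := ψ.symm.compactSpace
  exact (isCompact_iff_compactSpace.2 this).isClosed

/-- An open edge meeting a cycle is contained in it. -/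
theorem mem_cycle [Finite E] {C : Set G} (hC : IsCycleSet C) (δ : E × Bool) {t : ℝ}
    (ht : t ∈ Ioo 0 (M.len δ.1)) (htC : M.br δ t ∈ C) {s : ℝ} (hs : s ∈ Ioo 0 (M.len δ.1)) :
    M.br δ s ∈ C := by
  have hu : IsOpen {s | s ∈ Ioo 0 (M.len δ.1) ∧ M.br δ s ∈ C} := by
    refine isOpen_iff_mem_nhds.2 fun s hs => ?_
    filter_upwards [Ioo_mem_nhds hs.1.1 hs.1.2, M.eventually_mem_cycle hC δ hs.1 hs.2] with u h1 h2
      using ⟨h1, h2⟩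
  have hv : IsOpen {s | s ∈ Ioo 0 (M.len δ.1) ∧ M.br δ s ∈ Cᶜ} :=
    ((M.continuousOn δ).mono Ioo_subset_Icc_self).isOpen_inter_preimage isOpen_Ioo
      (isClosed_cycle hC).isOpen_compl
  exact (isPreconnected_Ioo.subset_left_of_subset_union hu hv
    (Set.disjoint_left.2 fun s h1 h2 => h2.2 h1.2)
    (fun s hs => (em (M.br δ s ∈ C)).imp (⟨hs, ·⟩) (⟨hs, ·⟩)) ⟨t, ht, ht, htC⟩ hs).2

open scoped Classical in
theorem exists_cycle_data [Fintype E] {C : Set G} (hC : IsCycleSet C) :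
    ∃ (F : Set E) (Z : Finset G), Z.Nonempty ∧ Z ⊆ M.W ∧ (∀ z ∈ Z, z ∈ C) ∧
      (∀ δ : E × Bool, δ.1 ∈ F → M.br δ 0 ∈ Z) ∧
      ∀ w ∈ Z, (Finset.univ.filter fun δ : E × Bool => M.br δ 0 = w ∧ δ.1 ∈ F).card = 2 := by
  have hF : ∀ δ : E × Bool, (∃ t ∈ Ioo 0 (M.len δ.1), M.br (δ.1, false) t ∈ C) →
      ∀ t ∈ Ioo 0 (M.len δ.1), M.br δ t ∈ C := by
    rintro δ ⟨s, hs, hsC⟩ t ht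
    obtain ⟨u, hu, hus⟩ := M.exists_br_of_mem δ ⟨s, hs, rfl⟩
    exact M.mem_cycle hC δ hu (hus ▸ hsC) ht
  have hF' : ∀ δ : E × Bool, (∃ t ∈ Ioo 0 (M.len δ.1), M.br δ t ∈ C) →
      ∃ t ∈ Ioo 0 (M.len δ.1), M.br (δ.1, false) t ∈ C := by
    rintro ⟨e, b⟩ ⟨t, ht, htC⟩
    cases b
    · exact ⟨t, ht, htC⟩
    · have h1 : M.br (e, true) t = M.br (e, false) (M.len e - t) := M.rev (e, false) t
      exact ⟨_, ⟨sub_pos.2 ht.2, sub_lt_self _ ht.1⟩, h1 ▸ htC⟩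
  have hsrc : ∀ δ : E × Bool, (∃ t ∈ Ioo 0 (M.len δ.1), M.br (δ.1, false) t ∈ C) →
      M.br δ 0 ∈ C := by
    intro δ h
    have hl := M.len_pos δ.1
    have h1 : (0 : ℝ) ∈ closure (Ioo 0 (M.len δ.1)) := by
      rw [closure_Ioo hl.ne]
      exact ⟨le_rfl, hl.le⟩
    have h2 := ((M.continuousOn δ 0 ⟨le_rfl, hl.le⟩).mono Ioo_subset_Icc_self).mem_closure_image h1
    refine (isClosed_cycle hC).closure_subset_iff.2 ?_ h2
    rintro _ ⟨t, ht, rfl⟩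
    exact hF δ h t ht
  refine ⟨{e | ∃ t ∈ Ioo 0 (M.len e), M.br (e, false) t ∈ C}, M.W.filter (· ∈ C), ?_,
    Finset.filter_subset _ _, fun z hz => (Finset.mem_filter.1 hz).2,
    fun δ hδ => Finset.mem_filter.2 ⟨M.src_mem δ, hsrc δ hδ⟩, fun w hw => ?_⟩
  · obtain ⟨ψ⟩ := hC
    obtain ⟨x, hx⟩ : C.Nonempty := ⟨_, (ψ.symm 0).2⟩
    rcases M.cover x with hxW | ⟨e, t, ht, rfl⟩
    · exact ⟨x, Finset.mem_filter.2 ⟨hxW, hx⟩⟩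
    · exact ⟨_, Finset.mem_filter.2 ⟨M.src_mem (e, false), hsrc (e, false) ⟨t, ht, hx⟩⟩⟩
  · obtain ⟨hwW, hwC⟩ := Finset.mem_filter.1 hw
    obtain ⟨r, hr⟩ := M.exists_mStar_vertex hwW
    obtain ⟨c, hc⟩ := exists_tStar_cycle hC hwC
    obtain ⟨ι, hι, h1, h2⟩ := hr.exists_injective hc
    have hl : ∀ δ : E × Bool, ∀ᶠ t in 𝓝[>] (0 : ℝ), t ∈ Ioo 0 (M.len δ.1) :=
      fun δ => Ioo_mem_nhdsGT (M.len_pos _)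
    have heq : (Finset.univ.filter fun δ : E × Bool => M.br δ 0 = w ∧
        δ.1 ∈ {e | ∃ t ∈ Ioo 0 (M.len e), M.br (e, false) t ∈ C}) =
        Finset.univ.image fun b => (ι b).1 := by
      ext δ
      simp only [Finset.mem_filter, Finset.mem_univ, true_and, Finset.mem_image]
      constructor
      · rintro ⟨hδ, hδF⟩
        by_contra hr
        have h3 := h2 ⟨δ, hδ⟩ (by
          rintro ⟨b, hb⟩
          exact hr ⟨b, congrArg Subtype.val hb⟩)
        obtain ⟨t, ht, ht'⟩ := (h3.and (hl δ)).exists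
        exact ht (hF δ hδF t ht')
      · rintro ⟨b, rfl⟩
        obtain ⟨t, ht, ht'⟩ := ((h1 b).and (hl _)).exists
        exact ⟨(ι b).2, hF' _ ⟨t, ht', ht⟩⟩
    rw [heq, Finset.card_image_of_injective (f := fun b => (ι b).1) _
      (Subtype.val_injective.comp hι)]
    rfl

end EdgeModel

/-! ### Rational functions in terms of edges -/

open Topology in
theorem MStar.continuousAt_of_hasSlopeAlong {J : Type*} [Finite J] {x : G} {σ : J → ℝ → G} {r : ℝ}
    (h : MStar x σ r) {f : G → ℝ} {s : J → ℤ} (hs : ∀ j, HasSlopeAlong f (σ j) (s j)) :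
    ContinuousAt f x := by
  refine Metric.tendsto_nhds.2 fun ε hε => h.eventually (by rwa [dist_self]) fun j => ?_
  obtain ⟨δ, hδ, hj⟩ := hs j
  have hc : Continuous fun t : ℝ => dist (f x + s j * t) (f x) := by fun_prop
  have h0 : ∀ᶠ t in 𝓝[>] (0 : ℝ), dist (f x + s j * t) (f x) < ε :=
    Filter.Eventually.filter_mono nhdsWithin_le_nhds
      ((hc.tendsto 0).eventually_lt_const (by simpa using hε))
  filter_upwards [h0, Ioo_mem_nhdsGT hδ] with t h1 h2
  rwa [hj t ⟨h2.1.le, h2.2⟩, (h.unit j).1]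

open Topology in
theorem hasSlopeAlong_iff {X : Type*} {f : X → ℝ} {γ : ℝ → X} {s : ℤ} :
    HasSlopeAlong f γ s ↔ ∀ᶠ t in 𝓝[>] (0 : ℝ), f (γ t) = f (γ 0) + s * t := by
  rw [eventually_Ioo_of_gt]
  constructor
  · rintro ⟨δ, hδ, h⟩
    exact ⟨δ, hδ, fun t ht => h t ⟨ht.1.le, ht.2⟩⟩
  · rintro ⟨δ, hδ, h⟩
    refine ⟨δ, hδ, fun t ht => ?_⟩
    rcases ht.1.eq_or_lt with rfl | h0
    · simp
    · exact h t ⟨h0, ht.2⟩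

namespace EdgeModel

open Topology

variable {E : Type*} (M : EdgeModel G E)

/-- The function which, along the dart `δ`, descends with slope `1` up to `τ δ`, then is constant
and finally ascends with slope `1`. -/
structure IsLevelFn (h : G → ℝ) (τ : E × Bool → ℝ) (f : G → ℝ) : Prop where
  nonneg : ∀ δ, 0 ≤ τ δ
  add_le : ∀ δ, τ δ + τ (δ.1, !δ.2) ≤ M.len δ.1
  eq : ∀ δ, ∀ t ∈ Icc 0 (M.len δ.1), f (M.br δ t) =
    h (M.br δ 0) - min t (τ δ) + max 0 (t - (M.len δ.1 - τ (δ.1, !δ.2)))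

theorem exists_isLevelFn {h : G → ℝ} {τ : E × Bool → ℝ} (h0 : ∀ δ, 0 ≤ τ δ)
    (hadd : ∀ δ, τ δ + τ (δ.1, !δ.2) ≤ M.len δ.1)
    (hcomp : ∀ δ, h (M.br δ 0) - τ δ = h (M.br (δ.1, !δ.2) 0) - τ (δ.1, !δ.2)) :
    ∃ f, M.IsLevelFn h τ f := by
  obtain ⟨f, hfW, hfe⟩ := M.exists_glue h fun e t =>
    h (M.br (e, false) 0) - min t (τ (e, false)) + max 0 (t - (M.len e - τ (e, true)))
  refine ⟨f, h0, hadd, fun δ t ht => ?_⟩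
  have h1 := h0 δ
  have h2 := h0 (δ.1, !δ.2)
  have h3 := hadd δ
  have h4 := hcomp δ
  rcases ht.1.eq_or_lt with rfl | ht0
  · rw [hfW _ (M.src_mem _), min_eq_left h1, max_eq_left (by linarith)]
    ring
  rcases ht.2.eq_or_lt with rfl | ht1
  · rw [M.br_len, hfW _ (M.src_mem _), min_eq_right (by linarith), max_eq_right (by linarith)]
    linarith
  obtain ⟨e, b⟩ := δ
  cases b
  · exact hfe e t ⟨ht0, ht1⟩
  · have h5 : M.br (e, true) t = M.br (e, false) (M.len e - t) := M.rev (e, false) t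
    simp only [Bool.not_true] at *
    rw [h5, hfe e _ ⟨sub_pos.2 ht1, sub_lt_self _ ht0⟩]
    rcases le_total (M.len e - t) (τ (e, false)) with h6 | h6 <;>
      rcases le_total t (τ (e, true)) with h7 | h7
    · rw [min_eq_left h6, min_eq_left h7, max_eq_right (by linarith), max_eq_right (by linarith)]
      linarith
    · rw [min_eq_left h6, min_eq_right h7, max_eq_left (by linarith), max_eq_right (by linarith)]
      linarith
    · rw [min_eq_right h6, min_eq_left h7, max_eq_right (by linarith), max_eq_left (by linarith)]
      linarith
    · rw [min_eq_right h6, min_eq_right h7, max_eq_left (by linarith), max_eq_left (by linarith)]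
      linarith

namespace IsLevelFn

variable {M} {h : G → ℝ} {τ : E × Bool → ℝ} {f : G → ℝ}

theorem eventually_lt_of_pos {c : ℝ} (hc : 0 < c) : ∀ᶠ t in 𝓝[>] (0 : ℝ), t < c :=
  Filter.Eventually.filter_mono nhdsWithin_le_nhds (eventually_lt_nhds hc)

open scoped Classical in
theorem hasSlopeAlong_src (hf : M.IsLevelFn h τ f) (δ : E × Bool) : HasSlopeAlong f (M.br δ)
    (-1 + ((if τ δ = 0 then 1 else 0) + if τ (δ.1, !δ.2) = M.len δ.1 then 1 else 0)) := by
  have hl := M.len_pos δ.1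
  have h1 := hf.nonneg δ
  have h2 := hf.nonneg (δ.1, !δ.2)
  have h3 := hf.add_le δ
  rw [hasSlopeAlong_iff]
  have e1 : ∀ᶠ t in 𝓝[>] (0 : ℝ), min t (τ δ) = t - t * if τ δ = 0 then 1 else 0 := by
    rcases h1.eq_or_lt with h4 | h4
    · filter_upwards [self_mem_nhdsWithin] with t ht
      simp [← h4, (mem_Ioi.1 ht).le]
    · filter_upwards [eventually_lt_of_pos h4] with t ht
      simp [h4.ne', ht.le]
  have e2 : ∀ᶠ t in 𝓝[>] (0 : ℝ), max 0 (t - (M.len δ.1 - τ (δ.1, !δ.2))) =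
      t * if τ (δ.1, !δ.2) = M.len δ.1 then 1 else 0 := by
    rcases (show τ (δ.1, !δ.2) ≤ M.len δ.1 by linarith).eq_or_lt with h4 | h4
    · filter_upwards [self_mem_nhdsWithin] with t ht
      simp [h4, (mem_Ioi.1 ht).le]
    · filter_upwards [eventually_lt_of_pos (sub_pos.2 h4)] with t ht
      rw [if_neg h4.ne, max_eq_left (sub_nonpos.2 ht.le), mul_zero]
  filter_upwards [e1, e2, Ioo_mem_nhdsGT hl] with t h4 h5 ht
  rw [hf.eq δ t (Ioo_subset_Icc_self ht), hf.eq δ 0 ⟨le_rfl, hl.le⟩, h4, h5, min_eq_left h1,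
    max_eq_left (by linarith)]
  push_cast
  ring

open scoped Classical in
/-- The outgoing slopes at an interior point of an edge. -/
theorem hasSlopeAlong_interior (hf : M.IsLevelFn h τ f) (δ : E × Bool) {t : ℝ}
    (ht : t ∈ Ioo 0 (M.len δ.1)) (b : Bool) :
    HasSlopeAlong f (fun s => M.br δ (if b then t + s else t - s))
      (if b then (if t < τ δ then -1 else 0) + (if M.len δ.1 - τ (δ.1, !δ.2) ≤ t then 1 else 0)
        else (if t ≤ τ δ then 1 else 0) + if M.len δ.1 - τ (δ.1, !δ.2) < t then -1 else 0) := by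
  set c := M.len δ.1 - τ (δ.1, !δ.2) with hc
  rw [hasSlopeAlong_iff]
  have hpos : ∀ᶠ s in 𝓝[>] (0 : ℝ), 0 < s := self_mem_nhdsWithin
  cases b
  · have e1 : ∀ᶠ s in 𝓝[>] (0 : ℝ), min (t - s) (τ δ) =
        min t (τ δ) - s * if t ≤ τ δ then 1 else 0 := by
      by_cases h4 : t ≤ τ δ
      · filter_upwards [hpos] with s hs
        rw [if_pos h4, min_eq_left h4, min_eq_left (by linarith), mul_one]
      · push Not at h4
        filter_upwards [eventually_lt_of_pos (sub_pos.2 h4)] with s hs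
        rw [if_neg h4.not_ge, min_eq_right h4.le, min_eq_right (by linarith), mul_zero, sub_zero]
    have e2 : ∀ᶠ s in 𝓝[>] (0 : ℝ), max 0 (t - s - c) =
        max 0 (t - c) + s * if c < t then -1 else 0 := by
      by_cases h4 : c < t
      · filter_upwards [eventually_lt_of_pos (sub_pos.2 h4)] with s hs
        rw [if_pos h4, max_eq_right (by linarith), max_eq_right (by linarith)]
        ring
      · push Not at h4
        filter_upwards [hpos] with s hs
        rw [if_neg h4.not_gt, max_eq_left (by linarith), max_eq_left (by linarith)]
        ring
    filter_upwards [e1, e2, hpos, eventually_lt_of_pos ht.1] with s h5 h6 h7 h8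
    simp only [Bool.false_eq_true, if_false, sub_zero]
    rw [hf.eq δ _ ⟨(sub_pos.2 h8).le, by linarith [ht.2]⟩, hf.eq δ t (Ioo_subset_Icc_self ht),
      h5, ← hc, h6]
    push_cast
    ring
  · have e1 : ∀ᶠ s in 𝓝[>] (0 : ℝ), min (t + s) (τ δ) =
        min t (τ δ) - s * if t < τ δ then -1 else 0 := by
      by_cases h4 : t < τ δ
      · filter_upwards [eventually_lt_of_pos (sub_pos.2 h4)] with s hs
        rw [if_pos h4, min_eq_left h4.le, min_eq_left (by linarith)]
        ring
      · push Not at h4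
        filter_upwards [hpos] with s hs
        rw [if_neg h4.not_gt, min_eq_right h4, min_eq_right (by linarith), mul_zero, sub_zero]
    have e2 : ∀ᶠ s in 𝓝[>] (0 : ℝ), max 0 (t + s - c) =
        max 0 (t - c) + s * if c ≤ t then 1 else 0 := by
      by_cases h4 : c ≤ t
      · filter_upwards [hpos] with s hs
        rw [if_pos h4, max_eq_right (by linarith), max_eq_right (by linarith)]
        ring
      · push Not at h4
        filter_upwards [eventually_lt_of_pos (sub_pos.2 h4)] with s hs
        rw [if_neg h4.not_ge, max_eq_left (by linarith), max_eq_left (by linarith)]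
        ring
    filter_upwards [e1, e2, hpos, eventually_lt_of_pos (sub_pos.2 ht.2)] with s h5 h6 h7 h8
    simp only [if_true, add_zero]
    rw [hf.eq δ _ ⟨by linarith [ht.1], by linarith⟩, hf.eq δ t (Ioo_subset_Icc_self ht),
      h5, ← hc, h6]
    push_cast
    ring

variable [Fintype E]

theorem isRational (hf : M.IsLevelFn h τ f) : IsRational f := by
  classical
  refine ⟨continuous_iff_continuousAt.2 fun x => ?_, fun x ε γ hε hγ => ?_⟩ <;>
    rcases M.cover x with hx | ⟨e, t, ht, rfl⟩
  · obtain ⟨r, hr⟩ := M.exists_mStar_vertex hx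
    exact hr.continuousAt_of_hasSlopeAlong fun δ => hf.hasSlopeAlong_src δ.1
  · obtain ⟨r, hr⟩ := M.exists_mStar_interior (e, false) ht
    exact hr.continuousAt_of_hasSlopeAlong (hf.hasSlopeAlong_interior (e, false) ht)
  · obtain ⟨r, hr⟩ := M.exists_mStar_vertex hx
    exact hr.hasSlopeAlong (fun δ => hf.hasSlopeAlong_src δ.1) hε hγ
  · obtain ⟨r, hr⟩ := M.exists_mStar_interior (e, false) ht
    exact hr.hasSlopeAlong (hf.hasSlopeAlong_interior (e, false) ht) hε hγ

open scoped Classical in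
theorem ordAt_vertex (hf : M.IsLevelFn h τ f) {w : G} (hw : w ∈ M.W) {v : ℕ}
    (hv : HasValence w v) : ordAt f w = -(v : ℤ) + ∑ δ with M.br δ 0 = w,
      ((if τ δ = 0 then 1 else 0) + if τ (δ.1, !δ.2) = M.len δ.1 then 1 else 0 : ℤ) := by
  obtain ⟨r, hr⟩ := M.exists_mStar_vertex hw
  rw [hr.ordAt_eq fun δ => hf.hasSlopeAlong_src δ.1, ← hr.card_eq_of_hasValence hv,
    Finset.sum_add_distrib]
  congr 1
  · simp
  · rw [Finset.sum_subtype (p := fun δ => M.br δ 0 = w) (F := inferInstance)]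
    simp

open scoped Classical in
theorem ordAt_interior (hf : M.IsLevelFn h τ f) (δ : E × Bool) {t : ℝ}
    (ht : t ∈ Ioo 0 (M.len δ.1)) : ordAt f (M.br δ t) =
      (if t = τ δ then 1 else 0) + if t = M.len δ.1 - τ (δ.1, !δ.2) then 1 else 0 := by
  obtain ⟨r, hr⟩ := M.exists_mStar_interior δ ht
  rw [hr.ordAt_eq (hf.hasSlopeAlong_interior δ ht), Fintype.sum_bool]
  simp only [if_true, Bool.false_eq_true, if_false]
  have key : ∀ a b : ℝ, (if a < b then -1 else 0) + (if a ≤ b then 1 else 0) =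
      if a = b then (1 : ℤ) else 0 := fun a b => by
    rcases lt_trichotomy a b with h | h | h
    · simp [h, h.le, h.ne]
    · simp [h]
    · simp [h.not_gt, h.not_ge, h.ne']
  have h1 := key t (τ δ)
  have h2 := key (M.len δ.1 - τ (δ.1, !δ.2)) t
  simp only [@eq_comm ℝ (M.len δ.1 - τ (δ.1, !δ.2)) t] at h2
  linarith

end IsLevelFn

theorem hasValence_interior [Finite E] (δ : E × Bool) {t : ℝ} (ht : t ∈ Ioo 0 (M.len δ.1)) {v : ℕ}
    (hv : HasValence (M.br δ t) v) : v = 2 := by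
  obtain ⟨r, hr⟩ := M.exists_mStar_interior δ ht
  rw [← hr.card_eq_of_hasValence hv, Fintype.card_bool]

end EdgeModel

/-! ### Counting components with locally constant labels -/

theorem finite_image_and_ncard_le {A : Set G} (hA : (compsOf A).Finite) {β : Type*} {L : G → β}
    (hL : ∀ x ∈ A, ∀ᶠ y in nhds x, y ∈ A → L y = L x) :
    (L '' A).Finite ∧ (L '' A).ncard ≤ (compsOf A).ncard := by
  rcases A.eq_empty_or_nonempty with rfl | ⟨x₀, -⟩
  · simp
  have : Nonempty G := ⟨x₀⟩
  set F : β → Set G := fun y => connectedComponentIn A (invFunOn L A y)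
  have hmaps : MapsTo F (L '' A) (compsOf A) := fun y hy => ⟨_, invFunOn_mem hy, rfl⟩
  suffices hinj : InjOn F (L '' A) from
    ⟨hA.of_injOn hmaps hinj, ncard_le_ncard_of_injOn F hmaps hinj hA⟩
  intro y hy z hz h
  let : TopologicalSpace β := ⊥
  have : DiscreteTopology β := ⟨rfl⟩
  have hc : ContinuousOn L A := fun x hx => by
    refine Filter.Tendsto.congr' ?_ (tendsto_const_nhds (x := L x))
    exact (eventually_nhdsWithin_iff.2 (hL x hx)).mono fun y hy => hy.symm
  have h1 : invFunOn L A z ∈ F y := by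
    rw [show F y = F z from h]
    exact mem_connectedComponentIn (invFunOn_mem hz)
  have := isPreconnected_connectedComponentIn.constant
    (hc.mono (connectedComponentIn_subset A (invFunOn L A y)))
    (mem_connectedComponentIn (invFunOn_mem hy)) h1
  rwa [invFunOn_eq hy, invFunOn_eq hz] at this

theorem finite_compsOf {ι : Type*} [Finite ι] {A : Set G} (P : ι → Set G)
    (hP : ∀ i, IsPreconnected (P i)) (hPA : ∀ i, P i ⊆ A) (hA : ∀ x ∈ A, ∃ i, x ∈ P i) :
    (compsOf A).Finite := by
  refine (Set.finite_iUnion (f := fun i => {C | ∃ x ∈ P i, C = connectedComponentIn A x})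
    fun i => Set.Subsingleton.finite ?_).subset ?_
  · rintro _ ⟨x, hx, rfl⟩ _ ⟨y, hy, rfl⟩
    exact connectedComponentIn_eq ((hP i).subset_connectedComponentIn hx (hPA i) hy)
  · rintro _ ⟨x, hx, rfl⟩
    obtain ⟨i, hi⟩ := hA x hx
    exact mem_iUnion.2 ⟨i, x, hi, rfl⟩

namespace EdgeModel

open Topology

variable {E : Type*} (M : EdgeModel G E)

/-- Labels of vertices extend to labels of the complement of the points at distance `τ δ` along
the darts `δ`, the middle part of an edge having a new label when it touches no vertex. -/
theorem exists_label {β : Type*} (lab : G → β) {τ : E × Bool → ℝ} (h0 : ∀ δ, 0 ≤ τ δ)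
    (hadd : ∀ δ, τ δ + τ (δ.1, !δ.2) ≤ M.len δ.1)
    (hlab : ∀ δ, τ δ = 0 → (τ (δ.1, !δ.2) = 0 ∨ τ (δ.1, !δ.2) = M.len δ.1) →
      lab (M.br δ 0) = lab (M.br (δ.1, !δ.2) 0)) :
    ∃ L : G → β ⊕ E, (∀ w ∈ M.W, L w = Sum.inl (lab w)) ∧
      ∀ δ, ∀ t ∈ Ioo 0 (M.len δ.1),
        (t < τ δ → L (M.br δ t) = Sum.inl (lab (M.br δ 0))) ∧
        (τ δ = 0 → t < M.len δ.1 - τ (δ.1, !δ.2) → L (M.br δ t) = Sum.inl (lab (M.br δ 0))) ∧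
        (0 < τ δ → 0 < τ (δ.1, !δ.2) → τ δ < t → t < M.len δ.1 - τ (δ.1, !δ.2) →
          L (M.br δ t) = Sum.inr δ.1) := by
  classical
  obtain ⟨L, hLW, hLe⟩ := M.exists_glue (fun w => Sum.inl (lab w)) fun e t =>
    if t < τ (e, false) then (Sum.inl (lab (M.br (e, false) 0)) : β ⊕ E)
    else if M.len e - τ (e, true) < t then Sum.inl (lab (M.br (e, true) 0))
    else if τ (e, false) = 0 then Sum.inl (lab (M.br (e, false) 0))
    else if τ (e, true) = 0 then Sum.inl (lab (M.br (e, true) 0))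
    else Sum.inr e
  refine ⟨L, hLW, ?_⟩
  rintro ⟨e, b⟩ t ht
  have h1 := h0 (e, false)
  have h2 := h0 (e, true)
  have h3 : τ (e, false) + τ (e, true) ≤ M.len e := hadd (e, false)
  cases b
  · rw [hLe e t ht]
    refine ⟨fun h => if_pos h, fun h h' => ?_, fun h h' h4 h5 => ?_⟩ <;>
      simp only [Bool.not_false] at *
    · rw [if_neg (by linarith [ht.1]), if_neg (by linarith), if_pos h]
    · rw [if_neg h4.not_gt, if_neg h5.not_gt, if_neg h.ne', if_neg h'.ne']
  · have h5 : M.br (e, true) t = M.br (e, false) (M.len e - t) := M.rev (e, false) t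
    simp only [Bool.not_true] at *
    rw [h5, hLe e _ ⟨sub_pos.2 ht.2, sub_lt_self _ ht.1⟩]
    refine ⟨fun h => ?_, fun h h' => ?_, fun h h' h4 h5 => ?_⟩
    · rw [if_neg (by linarith), if_pos (by linarith)]
    · rw [if_neg (by linarith), if_neg (by linarith [ht.1])]
      split_ifs with h6
      · rw [hlab (e, false) h6 (Or.inl h)]
        rfl
      · rfl
    · rw [if_neg (by linarith), if_neg (by linarith), if_neg h'.ne', if_neg h.ne']

/-- A set `S` of interior points of edges leaves at least as many components as there are labels
of vertices and edges which are cut off at both ends. -/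
theorem card_le_ncard_compsOf [Fintype E] [DecidableEq E] {β : Type*} [DecidableEq β]
    (lab : G → β) {τ : E × Bool → ℝ}
    (h0 : ∀ δ, 0 ≤ τ δ) (hadd : ∀ δ, τ δ + τ (δ.1, !δ.2) ≤ M.len δ.1)
    (hmid : ∀ δ, τ δ + τ (δ.1, !δ.2) = M.len δ.1 → τ δ = 0 ∨ τ (δ.1, !δ.2) = 0)
    (hlab : ∀ δ, τ δ = 0 → (τ (δ.1, !δ.2) = 0 ∨ τ (δ.1, !δ.2) = M.len δ.1) →
      lab (M.br δ 0) = lab (M.br (δ.1, !δ.2) 0)) {S : Set G} (hSW : ∀ w ∈ M.W, w ∉ S)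
    (hS : ∀ δ, ∀ t ∈ Ioo 0 (M.len δ.1),
      M.br δ t ∈ S ↔ t = τ δ ∨ t = M.len δ.1 - τ (δ.1, !δ.2))
    {B : Finset E} (hB : ∀ e ∈ B, ∀ b, 0 < τ (e, b)) :
    (M.W.image lab).card + B.card ≤ (compsOf Sᶜ).ncard := by
  obtain ⟨L, hLW, hL⟩ := M.exists_label lab h0 hadd hlab
  have hLrev : ∀ δ, ∀ t ∈ Ioo 0 (M.len δ.1), M.len δ.1 - τ (δ.1, !δ.2) < t →
      L (M.br δ t) = Sum.inl (lab (M.br (δ.1, !δ.2) 0)) := by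
    intro δ t ht h
    have h1 := (hL (δ.1, !δ.2) (M.len δ.1 - t) ⟨sub_pos.2 ht.2, sub_lt_self _ ht.1⟩).1
      (by linarith)
    have h2 := M.rev (δ.1, !δ.2) t
    simp only [Bool.not_not] at h2
    rw [← h1, ← h2]
  have hloc : ∀ x ∈ Sᶜ, ∀ᶠ y in 𝓝 x, y ∈ Sᶜ → L y = L x := by
    intro x hx
    rcases M.cover x with hxW | ⟨e, t, ht, rfl⟩
    · refine (M.eventually_vertex (P := fun y => L y = L x) hxW rfl ?_).mono fun y hy _ => hy
      rintro δ rfl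
      rw [hLW _ hxW]
      rcases (h0 δ).eq_or_lt with h1 | h1
      · have h2 := hadd δ
        rw [← h1, zero_add] at h2
        rcases h2.eq_or_lt with h3 | h3
        · filter_upwards [Ioo_mem_nhdsGT (M.len_pos δ.1)] with t ht
          rw [hLrev δ t ht (by rw [h3, sub_self]; exact ht.1), hlab δ h1.symm (Or.inr h3)]
        · filter_upwards [Ioo_mem_nhdsGT (M.len_pos δ.1), Ioo_mem_nhdsGT (sub_pos.2 h3)]
            with t ht ht' using (hL δ t ht).2.1 h1.symm ht'.2
      · filter_upwards [Ioo_mem_nhdsGT (M.len_pos δ.1), Ioo_mem_nhdsGT h1] with t ht ht'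
          using (hL δ t ht).1 ht'.2
    · have hS' := mt (hS (e, false) t ht).2 hx
      rw [not_or] at hS'
      obtain ⟨c, hc⟩ : ∃ c, ∀ᶠ s in 𝓝 t, L (M.br (e, false) s) = c := by
        have hIoo := Ioo_mem_nhds ht.1 ht.2
        rcases Ne.lt_or_gt hS'.1 with h1 | h1
        · refine ⟨Sum.inl (lab (M.br (e, false) 0)), ?_⟩
          filter_upwards [hIoo, Iio_mem_nhds h1] with s hs hs' using (hL (e, false) s hs).1 hs'
        rcases Ne.lt_or_gt hS'.2 with h2 | h2
        · rcases (h0 (e, false)).eq_or_lt with h3 | h3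
          · refine ⟨Sum.inl (lab (M.br (e, false) 0)), ?_⟩
            filter_upwards [hIoo, Iio_mem_nhds h2] with s hs hs'
              using (hL (e, false) s hs).2.1 h3.symm hs'
          rcases (h0 (e, true)).eq_or_lt with h4 | h4
          · refine ⟨Sum.inl (lab (M.br (e, true) 0)), ?_⟩
            filter_upwards [hIoo, Ioi_mem_nhds h1] with s hs hs'
            have h5 := (hL (e, true) (M.len e - s) ⟨sub_pos.2 hs.2, sub_lt_self _ hs.1⟩).2.1 h4.symm
              (sub_lt_sub_left hs' _)
            rwa [← M.rev (e, true)] at h5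
          · refine ⟨Sum.inr e, ?_⟩
            filter_upwards [hIoo, Ioi_mem_nhds h1, Iio_mem_nhds h2] with s hs hs' hs''
              using (hL (e, false) s hs).2.2 h3 h4 hs' hs''
        · refine ⟨Sum.inl (lab (M.br (e, true) 0)), ?_⟩
          filter_upwards [hIoo, Ioi_mem_nhds h2] with s hs hs' using hLrev (e, false) s hs hs'
      refine (M.eventually_interior (P := fun y => L y = c) (e, false) ht hc).mono fun y hy _ => ?_
      rw [hy, hc.self_of_nhds]
  have hfin : (compsOf Sᶜ).Finite := by
    refine finite_compsOf (ι := M.W ⊕ (E × Bool) ⊕ (E × Bool)) (Sum.elim (fun w => {w.1})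
      (Sum.elim (fun δ => M.br δ '' Ioo 0 (τ δ))
        fun δ => M.br δ '' Ioo (τ δ) (M.len δ.1 - τ (δ.1, !δ.2)))) ?_ ?_ ?_
    · rintro (w | δ | δ)
      · exact isPreconnected_singleton
      · refine isPreconnected_Ioo.image _ ((M.continuousOn δ).mono fun t ht => ⟨ht.1.le, ?_⟩)
        linarith [ht.2, hadd δ, h0 (δ.1, !δ.2)]
      · refine isPreconnected_Ioo.image _ ((M.continuousOn δ).mono fun t ht => ⟨?_, ?_⟩)
        · linarith [ht.1, h0 δ]
        · linarith [ht.2, h0 (δ.1, !δ.2)]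
    · rintro (w | δ | δ)
      · rintro _ rfl
        exact hSW _ w.2
      · rintro _ ⟨t, ht, rfl⟩ hmem
        have h1 := hadd δ
        have h2 := h0 (δ.1, !δ.2)
        rcases (hS δ t ⟨ht.1, by linarith [ht.2]⟩).1 hmem with h3 | h3 <;> linarith [ht.2]
      · rintro _ ⟨t, ht, rfl⟩ hmem
        have h1 := h0 δ
        have h2 := h0 (δ.1, !δ.2)
        rcases (hS δ t ⟨by linarith [ht.1], by linarith [ht.2]⟩).1 hmem with h3 | h3 <;>
          linarith [ht.1, ht.2]
    · intro x hx
      rcases M.cover x with hxW | ⟨e, t, ht, rfl⟩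
      · exact ⟨Sum.inl ⟨x, hxW⟩, rfl⟩
      · have hS' := mt (hS (e, false) t ht).2 hx
        rw [not_or] at hS'
        rcases Ne.lt_or_gt hS'.1 with h1 | h1
        · exact ⟨Sum.inr (Sum.inl (e, false)), t, ⟨ht.1, h1⟩, rfl⟩
        rcases Ne.lt_or_gt hS'.2 with h2 | h2
        · exact ⟨Sum.inr (Sum.inr (e, false)), t, ⟨h1, h2⟩, rfl⟩
        · refine ⟨Sum.inr (Sum.inl (e, true)), M.len e - t, ⟨sub_pos.2 ht.2, ?_⟩, ?_⟩
          · simp only [Bool.not_false] at h2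
            linarith
          · exact (M.rev (e, true) t).symm
  have hsub : (((M.W.image lab).disjSum B : Finset (β ⊕ E)) : Set (β ⊕ E)) ⊆ L '' Sᶜ := by
    intro y hy
    rcases Finset.mem_disjSum.1 (Finset.mem_coe.1 hy) with ⟨c, hc, rfl⟩ | ⟨e, he, rfl⟩
    · obtain ⟨w, hw, rfl⟩ := Finset.mem_image.1 hc
      exact ⟨w, hSW w hw, hLW w hw⟩
    · have h1 := hB e he false
      have h2 := hB e he true
      have h3 : τ (e, false) + τ (e, true) < M.len e :=
        (hadd (e, false)).lt_of_ne fun h => by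
          rcases hmid (e, false) h with h | h
          · exact h1.ne' h
          · exact h2.ne' h
      obtain ⟨t, ht1, ht2⟩ := exists_between (lt_sub_iff_add_lt.2 h3)
      have ht : t ∈ Ioo 0 (M.len e) := ⟨h1.trans ht1, by linarith⟩
      refine ⟨M.br (e, false) t, fun hmem => ?_, (hL (e, false) t ht).2.2 h1 h2 ht1 ht2⟩
      rcases (hS (e, false) t ht).1 hmem with h | h
      · exact ht1.ne' h
      · exact ht2.ne h
  have himage := finite_image_and_ncard_le hfin hloc
  calc (M.W.image lab).card + B.card
      = (((M.W.image lab).disjSum B : Finset (β ⊕ E)) : Set (β ⊕ E)).ncard := by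
        rw [ncard_coe_finset, Finset.card_disjSum]
    _ ≤ (L '' Sᶜ).ncard := ncard_le_ncard hsub himage.1
    _ ≤ _ := himage.2

end EdgeModel

/-! ### The canonical divisor defined by a level function -/

namespace EdgeModel

variable {E : Type*} {M : EdgeModel G E} {h : G → ℝ} {τ : E × Bool → ℝ} {f : G → ℝ}

theorem IsLevelFn.canonical_interior [Fintype E] (hf : M.IsLevelFn h τ f) {val : G → ℕ}
    (hval : ∀ x, HasValence x (val x)) (δ : E × Bool) {t : ℝ} (ht : t ∈ Ioo 0 (M.len δ.1)) :
    (0 : ℤ) ≤ (val (M.br δ t) : ℤ) - 2 + ordAt f (M.br δ t) ∧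
    ((val (M.br δ t) : ℤ) - 2 + ordAt f (M.br δ t) ≠ 0 ↔
      t = τ δ ∨ t = M.len δ.1 - τ (δ.1, !δ.2)) := by
  rw [hf.ordAt_interior δ ht, M.hasValence_interior δ ht (hval _)]
  split_ifs <;> simp_all

theorem IsLevelFn.mem_linSys [Fintype E] (hf : M.IsLevelFn h τ f) {val : G → ℕ}
    (hval : ∀ x, HasValence x (val x)) {K : G → ℤ} (hK : ∀ x, K x = (val x : ℤ) - 2)
    (hW : ∀ w ∈ M.W, K w + ordAt f w = 0) : (fun x => K x + ordAt f x) ∈ LinSys K := by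
  simp only [hK] at hW
  refine ⟨(finite_range fun δ => M.br δ (τ δ)).subset fun x hx => ?_, fun x => ?_,
    f, hf.isRational, fun _ => rfl⟩ <;>
    simp only [mem_support, hK] at * <;> rcases M.cover x with hxW | ⟨e, t, ht, rfl⟩
  · exact absurd (hW x hxW) hx
  · rcases (hf.canonical_interior hval (e, false) ht).2.1 hx with h1 | h1
    · exact ⟨(e, false), by rw [h1]⟩
    · refine ⟨(e, true), ?_⟩
      have h2 := M.rev (e, false) (τ (e, true))
      simp only [Bool.not_false] at h1 h2 ⊢
      rw [h2, h1]
  · exact (hW x hxW).ge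
  · exact (hf.canonical_interior hval (e, false) ht).1

theorem exists_cell [Fintype E] [ConnectedSpace G] (M : EdgeModel G E) {V : Set G} (hV : V.Finite)
    {val : G → ℕ} (hval : ∀ x, HasValence x (val x)) {K : G → ℤ} (hK : ∀ x, K x = (val x : ℤ) - 2)
    {C₁ C₂ : Set G} (hC₁ : IsCycleSet C₁) (hC₂ : IsCycleSet C₂) (hdisj : Disjoint C₁ C₂) :
    ∃ D ∈ LinSys K, (Fintype.card E : ℤ) - M.W.card + 1 ≤ cellDim V D := by
  classical
  obtain ⟨F₁, Z₁, hZ₁, hZW₁, hZC₁, hF₁, hc₁⟩ := M.exists_cycle_data hC₁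
  obtain ⟨F₂, Z₂, hZ₂, hZW₂, hZC₂, hF₂, hc₂⟩ := M.exists_cycle_data hC₂
  have hZ : Disjoint Z₁ Z₂ := Finset.disjoint_left.2 fun z h1 h2 =>
    disjoint_left.1 hdisj (hZC₁ z h1) (hZC₂ z h2)
  obtain ⟨z, hz⟩ := id hZ₁
  obtain ⟨h, τ, lab, h0, hadd, hcomp, hsum, hmid, hbad, hlab, hcard⟩ :=
    exists_levels M.W Z₁ Z₂ hZ₁ hZ₂ hZW₁ hZW₂ hZ (fun δ => M.br δ 0) M.src_mem M.len M.len_pos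
      F₁ F₂ hF₁ hF₂ hc₁ hc₂ (fun w hw => ⟨z, hz, M.reach (hZW₁ hz) hw⟩)
      (fun δ => {t | t ∈ Ioo 0 (M.len δ.1) ∧ M.br δ t ∈ V})
      (fun δ => Finite.of_injOn (fun t ht => ht.2)
        ((M.injOn δ).mono fun t ht => Ioo_subset_Icc_self ht.1) hV)
      (fun δ t ht => ⟨⟨sub_pos.2 ht.1.2, sub_lt_self _ ht.1.1⟩, by
        rw [← M.rev]
        exact ht.2⟩)
  obtain ⟨f, hf⟩ := M.exists_isLevelFn h0 hadd hcomp
  have hW : ∀ w ∈ M.W, K w + ordAt f w = 0 := fun w hw => by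
    have := hsum w hw
    rw [hK, hf.ordAt_vertex hw (hval w)]
    linarith
  refine ⟨_, hf.mem_linSys hval hK hW, ?_⟩
  have hbr : ∀ δ, τ δ ∈ Ioo 0 (M.len δ.1) → M.br δ (τ δ) ∉ V := fun δ hδ hmem =>
    hbad δ hδ.1 hδ.2 ⟨hδ, hmem⟩
  have key := M.card_le_ncard_compsOf lab h0 hadd hmid hlab
    (S := edgeSupp V fun x => K x + ordAt f x) (fun w hw hmem => hmem.2 (hW w hw))
    (fun δ t ht => ?_) (B := Finset.univ.filter fun e : E => ∀ b, 0 < τ (e, b))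
    fun e he => (Finset.mem_filter.1 he).2
  · unfold cellDim
    omega
  · have h1 := (hf.canonical_interior hval δ ht).2
    rw [← hK] at h1
    rw [← h1]
    refine ⟨fun hmem => hmem.2, fun hne => ⟨?_, hne⟩⟩
    rcases h1.1 hne with h2 | h2
    · subst h2
      exact hbr δ ht
    · have h3 := M.rev δ (τ (δ.1, !δ.2))
      rw [← h2] at h3
      rw [← h3]
      refine hbr (δ.1, !δ.2) ⟨?_, ?_⟩
      · linarith [ht.2]
      · linarith [ht.1]

end EdgeModel

/-- if `Γ` contains two disjoint (simple) cycles, then the canonical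
linear system `|K|` has a cell of dimension at least the genus `g`. -/
theorem disjoint_cycles_cell (hG : IsMetricGraph G) (hconn : ConnectedSpace G)
    (V : Set G) (hV : IsGraphModel V) (hVl : LoopFree V)
    (val : G → ℕ) (hval : ∀ x, HasValence x (val x))
    (K : G → ℤ) (hK : ∀ x, K x = (val x : ℤ) - 2)
    (C₁ C₂ : Set G) (hC₁ : IsCycleSet C₁) (hC₂ : IsCycleSet C₂)
    (hdisj : Disjoint C₁ C₂)
    (g : ℤ) (hg : HasGenusOpen (Set.univ : Set G) g) :
    ∃ D ∈ LinSys K, g ≤ cellDim V D := by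
  have := hG.1
  obtain ⟨E, _, M, rfl⟩ := exists_edgeModel_of_genus hg
  exact M.exists_cell hV.1 hval hK hC₁ hC₂ hdisj

end TropGraph
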